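/- arXiv:1512.06121 — 6 statements merged into one kernel-verified Lean document; each statement's English description precedes it below -/
import Mathlib

section
/- Fix a real number m > 0 and an integer n ≥ 1 with m + n > 2. Let φ : (0,∞) × ℝⁿ → ℂ be a smooth compactly supported function with δ(φ,M) < ‖φ‖_{Ḣ¹}. Then there exist z ∈ ℂ, t > 0, and x₀ ∈ ℝⁿ such that ‖φ − z F_{t,x₀}‖_{Ḣ¹} = δ(φ,M); that is, the infimum defining the distance to the manifold of Sobolev extremals is attained. -/
open MeasureTheory

noncomputable section

/-- Generalized surface area of the unit `(m−1)`-sphere, `ω_m = 2π^{m/2}/Γ(m/2)`. -/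
def omegaConst (m : ℝ) : ℝ := 2 * Real.pi ^ (m / 2) / Real.Gamma (m / 2)

/-- The measure `Λ` on `(0,∞) × ℝⁿ` given by `dΛ = ω_m ρ^{m−1} dρ dx`. -/
def cylMeasure (m : ℝ) (n : ℕ) : Measure (ℝ × EuclideanSpace ℝ (Fin n)) :=
  (((volume : Measure ℝ).restrict (Set.Ioi 0)).withDensity
      (fun ρ => ENNReal.ofReal (omegaConst m * ρ ^ (m - 1)))).prod
    (volume : Measure (EuclideanSpace ℝ (Fin n)))

/-- The critical exponent `2* = 2(m+n)/(m+n−2)`. -/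
def twoStar (m : ℝ) (n : ℕ) : ℝ := 2 * (m + n) / (m + n - 2)

/-- The exponent `γ = (m+n−2)/2`. -/
def gammaExp (m : ℝ) (n : ℕ) : ℝ := (m + n - 2) / 2

/-- The `L^p(Λ)` norm of a complex-valued cylindrically symmetric function. -/
def cylLpNorm (m : ℝ) (n : ℕ) (p : ℝ) (φ : ℝ × EuclideanSpace ℝ (Fin n) → ℂ) : ℝ :=
  (∫ z, ‖φ z‖ ^ p ∂(cylMeasure m n)) ^ (1 / p)

/-- Pointwise squared gradient `|∂_ρ φ|² + |∇_x φ|²`. -/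
def cylGradSq (n : ℕ) (φ : ℝ × EuclideanSpace ℝ (Fin n) → ℂ)
    (z : ℝ × EuclideanSpace ℝ (Fin n)) : ℝ :=
  ‖fderiv ℝ φ z (1, 0)‖ ^ 2 +
    ∑ i : Fin n, ‖fderiv ℝ φ z (0, EuclideanSpace.single i 1)‖ ^ 2

/-- The homogeneous Sobolev norm `‖φ‖_{Ḣ¹} = (∫ (|∂_ρ φ|² + |∇_x φ|²) dΛ)^{1/2}`. -/
def cylH1Norm (m : ℝ) (n : ℕ) (φ : ℝ × EuclideanSpace ℝ (Fin n) → ℂ) : ℝ :=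
  Real.sqrt (∫ z, cylGradSq n φ z ∂(cylMeasure m n))

/-- The extremal `F_{t,x₀}(ρ,x) = k₀ t^γ (1 + t²ρ² + t²|x−x₀|²)^{−γ}`. -/
def cylBubble (m : ℝ) (n : ℕ) (k₀ t : ℝ) (x₀ : EuclideanSpace ℝ (Fin n)) :
    ℝ × EuclideanSpace ℝ (Fin n) → ℂ :=
  fun z =>
    ((k₀ * t ^ gammaExp m n *
        (1 + t ^ 2 * z.1 ^ 2 + t ^ 2 * ‖z.2 - x₀‖ ^ 2) ^ (-(gammaExp m n)) : ℝ) : ℂ)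

/-- The distance `δ(φ, M) = inf_{z∈ℂ, t>0, x₀∈ℝⁿ} ‖φ − z F_{t,x₀}‖_{Ḣ¹}` from `φ` to
the manifold of extremals. -/
def cylDeltaM (m : ℝ) (n : ℕ) (k₀ : ℝ) (φ : ℝ × EuclideanSpace ℝ (Fin n) → ℂ) : ℝ :=
  ⨅ p : ℂ × {t : ℝ // 0 < t} × EuclideanSpace ℝ (Fin n),
    cylH1Norm m n (fun w => φ w - p.1 • cylBubble m n k₀ p.2.1.1 p.2.2 w)


/-- The radial factor of the measure. -/
def radMeas (m : ℝ) : Measure ℝ :=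
  ((volume : Measure ℝ).restrict (Set.Ioi 0)).withDensity
      (fun ρ => ENNReal.ofReal (omegaConst m * ρ ^ (m - 1)))

lemma radMeas_meas (m : ℝ) :
    Measurable (fun ρ : ℝ => ENNReal.ofReal (omegaConst m * ρ ^ (m - 1))) := by
  fun_prop

lemma cylMeasure_eq (m : ℝ) (n : ℕ) : cylMeasure m n = (radMeas m).prod volume := rfl

instance radMeas_sfinite (m : ℝ) : SFinite (radMeas m) := by
  unfold radMeas; infer_instance

lemma radMeas_finite (m : ℝ) (hm : 0 < m) : IsFiniteMeasureOnCompacts (radMeas m) := by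
  constructor
  intro K hK
  obtain ⟨R, hR, hKR⟩ := hK.isBounded.subset_closedBall_lt 0 0
  have hsub : K ⊆ Set.Iic R := by
    intro x hx
    have := hKR hx
    rw [Real.closedBall_eq_Icc] at this
    simpa using this.2
  refine lt_of_le_of_lt (measure_mono hsub) ?_
  have h1 : IntegrableOn (fun ρ : ℝ => omegaConst m * ρ ^ (m - 1)) (Set.Ioc 0 R) := by
    have := (intervalIntegral.intervalIntegrable_rpow' (a := 0) (b := R) (r := m - 1)
      (by linarith)).const_mul (omegaConst m)
    rwa [intervalIntegrable_iff_integrableOn_Ioc_of_le hR.le] at this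
  rw [radMeas, withDensity_apply _ measurableSet_Iic, Measure.restrict_restrict measurableSet_Iic,
    Set.inter_comm, Set.Ioi_inter_Iic]
  exact h1.lintegral_lt_top

lemma cylMeasure_finite (m : ℝ) (n : ℕ) (hm : 0 < m) :
    IsFiniteMeasureOnCompacts (cylMeasure m n) := by
  have := radMeas_finite m hm
  rw [cylMeasure_eq]; infer_instance

lemma radMeas_scale (m t : ℝ) (ht : 0 < t) :
    Measure.map (fun ρ => t * ρ) (radMeas m) = ENNReal.ofReal (t ^ (-m)) • radMeas m := by
  have hme := radMeas_meas m
  ext s hs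
  rw [Measure.map_apply (by fun_prop) hs, Measure.smul_apply, radMeas,
    withDensity_apply _ (hs.preimage (by fun_prop)), withDensity_apply _ hs,
    Measure.restrict_restrict (hs.preimage (by fun_prop)), Measure.restrict_restrict hs,
    ← lintegral_indicator ((hs.preimage (by fun_prop)).inter measurableSet_Ioi),
    ← lintegral_indicator (hs.inter measurableSet_Ioi), smul_eq_mul]
  have hv : (volume : Measure ℝ) = ENNReal.ofReal |t| • Measure.map (t * ·) volume :=
    (Real.smul_map_volume_mul_left ht.ne').symm
  conv_rhs => rw [hv]
  rw [lintegral_smul_measure, lintegral_map (hme.indicator (hs.inter measurableSet_Ioi))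
    (by fun_prop), smul_eq_mul, ← mul_assoc, ← lintegral_const_mul]
  · apply lintegral_congr
    intro ρ
    by_cases h : ρ ∈ (fun x => t * x) ⁻¹' s ∩ Set.Ioi 0
    · have h2 : t * ρ ∈ s ∩ Set.Ioi 0 := ⟨h.1, mul_pos ht h.2⟩
      rw [Set.indicator_of_mem h, Set.indicator_of_mem h2, ← ENNReal.ofReal_mul (by positivity),
        ← ENNReal.ofReal_mul (by positivity), abs_of_pos ht,
        Real.mul_rpow ht.le (le_of_lt h.2)]
      congr 1
      have : t ^ (-m) * t * t ^ (m - 1) = 1 := by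
        nth_rewrite 2 [← Real.rpow_one t]
        rw [← Real.rpow_add ht, ← Real.rpow_add ht]
        simp
      linear_combination (-omegaConst m * ρ ^ (m-1)) * this
    · have h2 : t * ρ ∉ s ∩ Set.Ioi 0 := by
        rintro ⟨a, b⟩
        exact h ⟨a, (mul_pos_iff_of_pos_left ht).1 b⟩
      rw [Set.indicator_of_notMem h, Set.indicator_of_notMem h2, mul_zero]
  · exact (hme.indicator (hs.inter measurableSet_Ioi)).comp (by fun_prop)

/-- The affine change of variables. -/
def affT (n : ℕ) (t : ℝ) (x₀ : EuclideanSpace ℝ (Fin n)) (w : ℝ × EuclideanSpace ℝ (Fin n)) :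
    ℝ × EuclideanSpace ℝ (Fin n) := (t * w.1, t • (w.2 - x₀))

lemma affT_meas (n : ℕ) (t : ℝ) (x₀ : EuclideanSpace ℝ (Fin n)) : Measurable (affT n t x₀) := by
  unfold affT; fun_prop

lemma cylMeasure_scale (m : ℝ) (n : ℕ) (t : ℝ) (ht : 0 < t) (x₀ : EuclideanSpace ℝ (Fin n)) :
    Measure.map (affT n t x₀) (cylMeasure m n)
      = ENNReal.ofReal (t ^ (-(m + n))) • cylMeasure m n := by
  have h0 : affT n t x₀ = Prod.map (fun ρ => t * ρ) (fun x => t • (x - x₀)) := rfl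
  have h2 : Measure.map (fun x : EuclideanSpace ℝ (Fin n) => t • (x - x₀)) volume
      = ENNReal.ofReal (t ^ (-(n : ℝ))) • volume := by
    have : (fun x : EuclideanSpace ℝ (Fin n) => t • (x - x₀))
      = (fun x => t • x) ∘ (fun x => x - x₀) := rfl
    rw [this, ← Measure.map_map (by fun_prop) (by fun_prop), map_sub_right_eq_self,
      Measure.map_addHaar_smul _ ht.ne', finrank_euclideanSpace_fin, abs_of_pos (by positivity),
      Real.rpow_neg ht.le, Real.rpow_natCast]
  rw [cylMeasure_eq, h0, ← Measure.map_prod_map _ _ (by fun_prop) (by fun_prop),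
    radMeas_scale m t ht, h2, Measure.prod_smul_left, Measure.prod_smul_right, smul_smul,
    ← ENNReal.ofReal_mul (by positivity), ← Real.rpow_add ht, neg_add]

/-- Coordinate directions. -/
def dirE (n : ℕ) : Option (Fin n) → ℝ × EuclideanSpace ℝ (Fin n)
  | none => (1, 0)
  | some i => (0, EuclideanSpace.single i 1)

/-- The gradient as a Euclidean vector. -/
def cylGrad (n : ℕ) (φ : ℝ × EuclideanSpace ℝ (Fin n) → ℂ)
    (w : ℝ × EuclideanSpace ℝ (Fin n)) : EuclideanSpace ℂ (Option (Fin n)) :=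
  WithLp.toLp 2 (fun i => fderiv ℝ φ w (dirE n i))

lemma cylGradSq_eq (n : ℕ) (φ : ℝ × EuclideanSpace ℝ (Fin n) → ℂ)
    (w : ℝ × EuclideanSpace ℝ (Fin n)) : cylGradSq n φ w = ‖cylGrad n φ w‖ ^ 2 := by
  rw [EuclideanSpace.norm_sq_eq, Fintype.sum_option]
  rfl

/-- The displacement vector. -/
def uvec (n : ℕ) (x₀ : EuclideanSpace ℝ (Fin n)) (w : ℝ × EuclideanSpace ℝ (Fin n)) :
    EuclideanSpace ℂ (Option (Fin n)) :=
  WithLp.toLp 2 (fun i => Option.elim i (w.1 : ℂ) (fun j => (((w.2 - x₀) j : ℝ) : ℂ)))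

lemma uvec_norm_sq (n : ℕ) (x₀ : EuclideanSpace ℝ (Fin n)) (w : ℝ × EuclideanSpace ℝ (Fin n)) :
    ‖uvec n x₀ w‖ ^ 2 = w.1 ^ 2 + ‖w.2 - x₀‖ ^ 2 := by
  rw [EuclideanSpace.norm_sq_eq, Fintype.sum_option, EuclideanSpace.norm_sq_eq]
  simp only [uvec, Option.elim, Complex.norm_real, Real.norm_eq_abs, sq_abs]

lemma uvec_cont (n : ℕ) : Continuous (fun p : EuclideanSpace ℝ (Fin n) ×
    (ℝ × EuclideanSpace ℝ (Fin n)) => uvec n p.1 p.2) := by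
  unfold uvec
  refine (PiLp.continuous_toLp 2 _).comp ?_
  refine continuous_pi ?_
  rintro (_ | j)
  · simp only [Option.elim]; fun_prop
  · simp only [Option.elim]; fun_prop

/-- The quadratic base. -/
def Qf (n : ℕ) (t : ℝ) (x₀ : EuclideanSpace ℝ (Fin n)) (w : ℝ × EuclideanSpace ℝ (Fin n)) : ℝ :=
  1 + t ^ 2 * w.1 ^ 2 + t ^ 2 * ‖w.2 - x₀‖ ^ 2

lemma Qf_eq (n : ℕ) (t : ℝ) (x₀ : EuclideanSpace ℝ (Fin n)) (w : ℝ × EuclideanSpace ℝ (Fin n)) :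
    Qf n t x₀ w = 1 + t ^ 2 * ‖uvec n x₀ w‖ ^ 2 := by
  rw [uvec_norm_sq, Qf]; ring

lemma Qf_ge (n : ℕ) (t : ℝ) (x₀ : EuclideanSpace ℝ (Fin n)) (w : ℝ × EuclideanSpace ℝ (Fin n)) :
    1 ≤ Qf n t x₀ w := by
  rw [Qf_eq]; nlinarith [mul_nonneg (sq_nonneg t) (sq_nonneg ‖uvec n x₀ w‖)]

/-- Explicit gradient of the bubble. -/
def bubGrad (m : ℝ) (n : ℕ) (k₀ t : ℝ) (x₀ : EuclideanSpace ℝ (Fin n))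
    (w : ℝ × EuclideanSpace ℝ (Fin n)) : EuclideanSpace ℂ (Option (Fin n)) :=
  ((-(2 * gammaExp m n * k₀ * t ^ (gammaExp m n + 2) * Qf n t x₀ w ^ (-gammaExp m n - 1)) : ℝ) : ℂ)
    • uvec n x₀ w

lemma bubble_hasFDerivAt (m : ℝ) (n : ℕ) (k₀ t : ℝ) (ht : 0 < t) (x₀ : EuclideanSpace ℝ (Fin n))
    (w : ℝ × EuclideanSpace ℝ (Fin n)) :
    HasFDerivAt (cylBubble m n k₀ t x₀)
      (Complex.ofRealCLM.comp
        ((-(2 * gammaExp m n * k₀ * t ^ (gammaExp m n + 2) * Qf n t x₀ w ^ (-gammaExp m n - 1))) •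
          (w.1 • ContinuousLinearMap.fst ℝ ℝ (EuclideanSpace ℝ (Fin n)) +
            (innerSL ℝ (w.2 - x₀)).comp
              (ContinuousLinearMap.snd ℝ ℝ (EuclideanSpace ℝ (Fin n)))))) w := by
  have h1 : HasFDerivAt (fun z : ℝ × EuclideanSpace ℝ (Fin n) => z.1)
    (ContinuousLinearMap.fst ℝ ℝ (EuclideanSpace ℝ (Fin n))) w := hasFDerivAt_fst
  have h2 : HasFDerivAt (fun z : ℝ × EuclideanSpace ℝ (Fin n) => z.2 - x₀)
    (ContinuousLinearMap.snd ℝ ℝ (EuclideanSpace ℝ (Fin n))) w := hasFDerivAt_snd.sub_const x₀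
  have h3 := ((((h1.pow 2).const_mul (t ^ 2)).const_add 1).add
    ((h2.norm_sq).const_mul (t ^ 2)))
  have hQ : (1 + t ^ 2 * w.1 ^ 2) + t ^ 2 * ‖w.2 - x₀‖ ^ 2 = Qf n t x₀ w := rfl
  have hQ0 : Qf n t x₀ w ≠ 0 := (lt_of_lt_of_le one_pos (Qf_ge n t x₀ w)).ne'
  have h4 := (h3.rpow_const (p := -gammaExp m n) (Or.inl hQ0)).const_mul
    (k₀ * t ^ gammaExp m n)
  have h5 := Complex.ofRealCLM.hasFDerivAt.comp w h4
  refine HasFDerivAt.congr_fderiv (f := cylBubble m n k₀ t x₀) h5 ?_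
  congr 1
  ext v
  · simp [hQ, Real.rpow_add ht]
    ring
  · simp [hQ, Real.rpow_add ht]
    ring

lemma bubble_grad (m : ℝ) (n : ℕ) (k₀ t : ℝ) (ht : 0 < t) (x₀ : EuclideanSpace ℝ (Fin n))
    (w : ℝ × EuclideanSpace ℝ (Fin n)) :
    cylGrad n (cylBubble m n k₀ t x₀) w = bubGrad m n k₀ t x₀ w := by
  unfold cylGrad
  rw [(bubble_hasFDerivAt m n k₀ t ht x₀ w).fderiv]
  ext i
  cases i with
  | none => simp [bubGrad, uvec, dirE]
  | some i => simp [bubGrad, uvec, dirE, EuclideanSpace.inner_single_right]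

lemma bubGrad_cont (m : ℝ) (n : ℕ) (k₀ : ℝ) :
    Continuous (fun p : (ℝ × EuclideanSpace ℝ (Fin n)) × (ℝ × EuclideanSpace ℝ (Fin n)) =>
      bubGrad m n k₀ (Real.exp p.1.1) p.1.2 p.2) := by
  unfold bubGrad
  refine Continuous.smul (Complex.continuous_ofReal.comp (Continuous.neg (Continuous.mul
    (Continuous.mul continuous_const ?_) ?_))) ?_
  · exact Continuous.rpow_const (by fun_prop) (fun p => Or.inl (Real.exp_ne_zero _))
  · refine Continuous.rpow_const ?_ (fun p => Or.inl
      (lt_of_lt_of_le one_pos (Qf_ge n _ _ _)).ne')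
    unfold Qf
    fun_prop
  · exact (uvec_cont n).comp (f := fun p : (ℝ × EuclideanSpace ℝ (Fin n)) ×
      (ℝ × EuclideanSpace ℝ (Fin n)) => (p.1.2, p.2)) (by fun_prop)

lemma bubGrad_scale (m : ℝ) (n : ℕ) (k₀ t : ℝ) (ht : 0 < t) (x₀ : EuclideanSpace ℝ (Fin n))
    (w : ℝ × EuclideanSpace ℝ (Fin n)) :
    bubGrad m n k₀ t x₀ w
      = ((t ^ (gammaExp m n + 1) : ℝ) : ℂ) • bubGrad m n k₀ 1 0 (affT n t x₀ w) := by
  have h1 : uvec n 0 (affT n t x₀ w) = (t : ℂ) • uvec n x₀ w := by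
    ext i
    cases i <;> simp [uvec, affT]
  have h2 : Qf n 1 0 (affT n t x₀ w) = Qf n t x₀ w := by
    rw [Qf_eq, Qf_eq, h1, norm_smul]
    simp [mul_pow]
  unfold bubGrad
  rw [h1, h2, smul_smul, smul_smul]
  congr 1
  have : t ^ (gammaExp m n + 2) = t ^ (gammaExp m n + 1) * t := by
    rw [← Real.rpow_add_one ht.ne']; ring_nf
  rw [this]
  push_cast
  simp only [Real.one_rpow, Complex.ofReal_one]
  ring

lemma bubGrad_norm (m : ℝ) (n : ℕ) (k₀ t : ℝ) (ht : 0 < t) (hk : 0 < k₀) (hg : 0 < gammaExp m n)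
    (x₀ : EuclideanSpace ℝ (Fin n)) (w : ℝ × EuclideanSpace ℝ (Fin n)) :
    ‖bubGrad m n k₀ t x₀ w‖ = 2 * gammaExp m n * k₀ * t ^ (gammaExp m n + 2)
      * Qf n t x₀ w ^ (-gammaExp m n - 1) * ‖uvec n x₀ w‖ := by
  have hQ0 : 0 < Qf n t x₀ w := (lt_of_lt_of_le one_pos (Qf_ge n t x₀ w))
  rw [bubGrad, norm_smul, Complex.norm_real, norm_neg, Real.norm_of_nonneg (by positivity)]

lemma bubGrad_small (m : ℝ) (n : ℕ) (k₀ t : ℝ) (ht : 0 < t) (hk : 0 < k₀) (hg : 0 < gammaExp m n)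
    (x₀ : EuclideanSpace ℝ (Fin n)) (w : ℝ × EuclideanSpace ℝ (Fin n)) :
    ‖bubGrad m n k₀ t x₀ w‖ ≤ 2 * gammaExp m n * k₀ * t ^ (gammaExp m n + 1) := by
  have hQ1 := Qf_ge n t x₀ w
  have hQ0 : 0 < Qf n t x₀ w := (lt_of_lt_of_le one_pos hQ1)
  rw [bubGrad_norm m n k₀ t ht hk hg]
  set g := gammaExp m n
  set Q := Qf n t x₀ w with hQ
  have : t ^ (g + 2) = t ^ (g + 1) * t := by
    rw [← Real.rpow_add_one ht.ne']; ring_nf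
  rw [this]
  have h1 : t * ‖uvec n x₀ w‖ ≤ Q := by
    rw [hQ, Qf_eq]; nlinarith [sq_nonneg (t * ‖uvec n x₀ w‖ - 1), sq_nonneg (t * ‖uvec n x₀ w‖)]
  have h2 : Q ^ (-g - 1) * (t * ‖uvec n x₀ w‖) ≤ 1 := by
    calc Q ^ (-g - 1) * (t * ‖uvec n x₀ w‖) ≤ Q ^ (-g - 1) * Q := by gcongr
      _ = Q ^ (-g) := by rw [← Real.rpow_add_one hQ0.ne']; ring_nf
      _ ≤ 1 := Real.rpow_le_one_of_one_le_of_nonpos hQ1 (by linarith)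
  calc _ = 2 * g * k₀ * t ^ (g + 1) * (Q ^ (-g - 1) * (t * ‖uvec n x₀ w‖)) := by ring
    _ ≤ 2 * g * k₀ * t ^ (g + 1) * 1 := by gcongr
    _ = _ := by ring

lemma bubGrad_far (m : ℝ) (n : ℕ) (k₀ t : ℝ) (ht : 0 < t) (hk : 0 < k₀) (hg : 0 < gammaExp m n)
    (x₀ : EuclideanSpace ℝ (Fin n)) (w : ℝ × EuclideanSpace ℝ (Fin n)) (η : ℝ) (hη : 0 < η)
    (hu : η ≤ ‖uvec n x₀ w‖) :
    ‖bubGrad m n k₀ t x₀ w‖ ≤ 2 * gammaExp m n * k₀ * t ^ (-gammaExp m n)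
      * η ^ (-(2 * gammaExp m n + 1)) := by
  rw [bubGrad_norm m n k₀ t ht hk hg]
  set g := gammaExp m n
  set r := ‖uvec n x₀ w‖
  have hr : 0 < r := lt_of_lt_of_le hη hu
  have h1 : Qf n t x₀ w ^ (-g - 1) ≤ t ^ (-2 * g - 2) * r ^ (-2 * g - 2) := by
    calc Qf n t x₀ w ^ (-g - 1) ≤ ((t * r) ^ (2 : ℝ)) ^ (-g - 1) := by
          apply Real.rpow_le_rpow_of_nonpos (by positivity) _ (by linarith)
          rw [Qf_eq, Real.rpow_two, mul_pow]; linarith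
      _ = _ := by
          rw [← Real.rpow_mul (by positivity), Real.mul_rpow ht.le hr.le]; ring_nf
  have h3 : r ^ (-(2 * g + 1)) ≤ η ^ (-(2 * g + 1)) :=
    Real.rpow_le_rpow_of_nonpos hη hu (by linarith)
  have h4 : t ^ (g + 2) * t ^ (-2 * g - 2) = t ^ (-g) := by
    rw [← Real.rpow_add ht]; ring_nf
  have h5 : r ^ (-2 * g - 2) * r = r ^ (-(2 * g + 1)) := by
    rw [← Real.rpow_add_one hr.ne']; ring_nf
  calc _ ≤ 2 * g * k₀ * t ^ (g + 2) * (t ^ (-2 * g - 2) * r ^ (-2 * g - 2)) * r := by gcongr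
    _ = 2 * g * k₀ * (t ^ (g + 2) * t ^ (-2 * g - 2)) * (r ^ (-2 * g - 2) * r) := by ring
    _ ≤ _ := by rw [h4, h5]; gcongr

lemma inner_toLp {α V : Type*} [MeasurableSpace α] [NormedAddCommGroup V] [InnerProductSpace ℂ V]
    {μ : Measure α} {f g : α → V} (hf : MemLp f 2 μ) (hg : MemLp g 2 μ) :
    inner ℂ (hf.toLp f) (hg.toLp g) = ∫ a, inner ℂ (f a) (g a) ∂μ := by
  rw [L2.inner_def]
  apply integral_congr_ae
  filter_upwards [hf.coeFn_toLp, hg.coeFn_toLp] with a h1 h2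
  rw [h1, h2]

lemma normsq_toLp {α V : Type*} [MeasurableSpace α] [NormedAddCommGroup V] [InnerProductSpace ℂ V]
    {μ : Measure α} {f : α → V} (hf : MemLp f 2 μ) :
    ‖hf.toLp f‖ ^ 2 = ∫ a, ‖f a‖ ^ 2 ∂μ := by
  have h := inner_toLp hf hf
  simp only [inner_self_eq_norm_sq_to_K] at h
  have h2 : ∀ a, ((‖f a‖ : ℂ)) ^ 2 = ((‖f a‖ ^ 2 : ℝ) : ℂ) := by intro a; push_cast; rfl
  have h3 : ∫ a, ((‖f a‖ : ℂ)) ^ 2 ∂μ = ((∫ a, ‖f a‖ ^ 2 ∂μ : ℝ) : ℂ) := by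
    simp_rw [h2]; exact integral_ofReal
  have h4 : ((‖hf.toLp f‖ ^ 2 : ℝ) : ℂ) = ((∫ a, ‖f a‖ ^ 2 ∂μ : ℝ) : ℂ) := by
    rw [← h3]; push_cast; exact h
  exact_mod_cast h4

lemma cylH1Norm_eq (m : ℝ) (n : ℕ) (ψ : ℝ × EuclideanSpace ℝ (Fin n) → ℂ)
    (h : MemLp (cylGrad n ψ) 2 (cylMeasure m n)) : cylH1Norm m n ψ = ‖h.toLp‖ := by
  unfold cylH1Norm
  simp_rw [cylGradSq_eq]
  rw [← normsq_toLp h, Real.sqrt_sq (norm_nonneg _)]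

lemma bubGrad_cont' (m : ℝ) (n : ℕ) (k₀ t : ℝ) (ht : 0 < t) (x₀ : EuclideanSpace ℝ (Fin n)) :
    Continuous (bubGrad m n k₀ t x₀) := by
  have := (bubGrad_cont m n k₀).comp (f := fun w : ℝ × EuclideanSpace ℝ (Fin n) =>
    ((Real.log t, x₀), w)) (by fun_prop)
  simpa [Function.comp_def, Real.exp_log ht] using this

lemma bub_one (m : ℝ) (n : ℕ) (k₀ : ℝ)
    (hnorm : cylH1Norm m n (cylBubble m n k₀ 1 0) = 1) :
    MemLp (bubGrad m n k₀ 1 0) 2 (cylMeasure m n) ∧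
      ∫ w, ‖bubGrad m n k₀ 1 0 w‖ ^ 2 ∂(cylMeasure m n) = 1 := by
  unfold cylH1Norm at hnorm
  simp_rw [cylGradSq_eq, bubble_grad m n k₀ 1 one_pos 0] at hnorm
  rw [Real.sqrt_eq_one] at hnorm
  refine ⟨?_, hnorm⟩
  rw [memLp_two_iff_integrable_sq_norm (bubGrad_cont' m n k₀ 1 one_pos 0).aestronglyMeasurable]
  by_contra hc
  rw [integral_undef hc] at hnorm
  exact zero_ne_one hnorm

lemma bub_all (m : ℝ) (n : ℕ) (k₀ : ℝ)
    (hnorm : cylH1Norm m n (cylBubble m n k₀ 1 0) = 1) (t : ℝ) (ht : 0 < t)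
    (x₀ : EuclideanSpace ℝ (Fin n)) :
    MemLp (bubGrad m n k₀ t x₀) 2 (cylMeasure m n) ∧
      ∫ w, ‖bubGrad m n k₀ t x₀ w‖ ^ 2 ∂(cylMeasure m n) = 1 := by
  obtain ⟨h1, h2⟩ := bub_one m n k₀ hnorm
  have he : bubGrad m n k₀ t x₀ = fun w => ((t ^ (gammaExp m n + 1) : ℝ) : ℂ) •
    bubGrad m n k₀ 1 0 (affT n t x₀ w) := funext (bubGrad_scale m n k₀ t ht x₀)
  have hT := affT_meas n t x₀
  have hs := cylMeasure_scale m n t ht x₀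
  have h3 : MemLp (bubGrad m n k₀ 1 0) 2 (Measure.map (affT n t x₀) (cylMeasure m n)) := by
    rw [hs]; exact h1.smul_measure ENNReal.ofReal_ne_top
  constructor
  · rw [he]
    exact (h3.comp_of_map hT.aemeasurable).const_smul (((t ^ (gammaExp m n + 1) : ℝ) : ℂ))
  · have h4 : ∀ w, ‖bubGrad m n k₀ t x₀ w‖ ^ 2 = (t ^ (gammaExp m n + 1)) ^ 2 *
        ‖bubGrad m n k₀ 1 0 (affT n t x₀ w)‖ ^ 2 := by
      intro w
      rw [bubGrad_scale m n k₀ t ht x₀, norm_smul, mul_pow, Complex.norm_real,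
        Real.norm_of_nonneg (by positivity)]
    simp_rw [h4]
    rw [integral_const_mul]
    have h5 := integral_map (μ := cylMeasure m n) hT.aemeasurable
      (f := fun w => ‖bubGrad m n k₀ 1 0 w‖ ^ 2)
      ((bubGrad_cont' m n k₀ 1 one_pos 0).norm.pow 2).aestronglyMeasurable
    rw [← h5, hs, integral_smul_measure, h2, ENNReal.toReal_ofReal (by positivity), smul_eq_mul,
      mul_one, ← Real.rpow_natCast, ← Real.rpow_mul ht.le, ← Real.rpow_add ht]
    have : (gammaExp m n + 1) * ((2 : ℕ) : ℝ) + -(m + n) = 0 := by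
      unfold gammaExp; push_cast; ring
    rw [this, Real.rpow_zero]

lemma cylGrad_cont (n : ℕ) (φ : ℝ × EuclideanSpace ℝ (Fin n) → ℂ)
    (hφ : ContDiff ℝ (⊤ : ℕ∞) φ) : Continuous (cylGrad n φ) := by
  unfold cylGrad
  refine (PiLp.continuous_toLp 2 _).comp (continuous_pi fun i => ?_)
  exact (hφ.continuous_fderiv (by simp)).clm_apply continuous_const

lemma cylGrad_supp (n : ℕ) (φ : ℝ × EuclideanSpace ℝ (Fin n) → ℂ)
    (hφ : HasCompactSupport φ) : HasCompactSupport (cylGrad n φ) := by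
  exact (hφ.fderiv ℝ).comp_left (g := fun L : (ℝ × EuclideanSpace ℝ (Fin n)) →L[ℝ] ℂ =>
    (WithLp.toLp 2 (fun i => L (dirE n i)) : EuclideanSpace ℂ (Option (Fin n)))) (by ext i; simp)

lemma null_set (m : ℝ) (n : ℕ) :
    cylMeasure m n {w | w.1 ≤ 0} = 0 := by
  have : {w : ℝ × EuclideanSpace ℝ (Fin n) | w.1 ≤ 0} = Set.Iic 0 ×ˢ Set.univ := by
    ext w; simp
  rw [this, cylMeasure_eq, Measure.prod_prod, radMeas, withDensity_apply _ measurableSet_Iic,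
    Measure.restrict_restrict measurableSet_Iic, Set.inter_comm, Set.Ioi_inter_Iic]
  simp

lemma exists_eta (m : ℝ) (n : ℕ) (g : ℝ × EuclideanSpace ℝ (Fin n) → ℝ)
    (hg : Integrable g (cylMeasure m n)) (ε : ℝ) (hε : 0 < ε) :
    ∃ η > 0, ∫ w in {w | w.1 < η}, g w ∂(cylMeasure m n) < ε := by
  have h := tendsto_setIntegral_of_antitone (μ := cylMeasure m n) (f := g)
    (s := fun k : ℕ => {w | w.1 < 1 / ((k : ℝ) + 1)})
    (fun k => measurableSet_lt measurable_fst measurable_const)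
    (fun a b hab w hw => by
      simp only [Set.mem_ofPred_eq] at hw ⊢
      exact lt_of_lt_of_le hw (Nat.one_div_le_one_div hab))
    ⟨0, hg.integrableOn⟩
  have h0 : ∫ w in ⋂ k : ℕ, {w | w.1 < 1 / ((k : ℝ) + 1)}, g w ∂(cylMeasure m n) = 0 := by
    apply setIntegral_measure_zero
    refine measure_mono_null ?_ (null_set m n)
    intro w hw
    simp only [Set.mem_iInter, Set.mem_ofPred_eq] at hw
    exact ge_of_tendsto' tendsto_one_div_add_atTop_nhds_zero_nat (fun k => (hw k).le)
  rw [h0] at h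
  obtain ⟨k, hk⟩ := (h.eventually (gt_mem_nhds hε)).exists
  exact ⟨_, Nat.one_div_pos_of_nat, hk⟩

lemma inner_bound {α V : Type*} [MeasurableSpace α] [NormedAddCommGroup V] [InnerProductSpace ℂ V]
    {μ : Measure α} {f g : α → V} (hf : MemLp f 2 μ) (hg : MemLp g 2 μ) (hg1 : Integrable g μ)
    (hf1 : ‖hf.toLp f‖ = 1)
    (A : Set α) (hA : MeasurableSet A) (B : ℝ) (hB0 : 0 ≤ B)
    (hB : ∀ w, w ∉ A → g w ≠ 0 → ‖f w‖ ≤ B) (δ : ℝ) (hδ : 0 ≤ δ)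
    (hAd : ∫ w in A, ‖g w‖ ^ 2 ∂μ ≤ δ ^ 2) :
    ‖(inner ℂ (hf.toLp f) (hg.toLp g) : ℂ)‖ ≤ δ + B * ∫ w, ‖g w‖ ∂μ := by
  have e : hg.toLp g = (hg.indicator hA).toLp (A.indicator g)
      + (hg.indicator hA.compl).toLp (Aᶜ.indicator g) := by
    rw [← MemLp.toLp_add]
    congr 1
    exact (Set.indicator_self_add_compl A g).symm
  rw [e, inner_add_right]
  refine (norm_add_le _ _).trans (add_le_add ?_ ?_)
  · refine (norm_inner_le_norm _ _).trans ?_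
    rw [hf1, one_mul]
    refine le_of_abs_le (abs_le_of_sq_le_sq ?_ hδ)
    rw [normsq_toLp]
    refine le_trans (le_of_eq ?_) hAd
    rw [← integral_indicator hA]
    congr 1
    ext w
    by_cases hw : w ∈ A <;> simp [hw]
  · rw [inner_toLp, ← integral_const_mul]
    refine norm_integral_le_of_norm_le (hg1.norm.const_mul B) (Filter.Eventually.of_forall ?_)
    intro w
    refine (norm_inner_le_norm _ _).trans ?_
    by_cases hw : w ∈ A
    · simp only [Set.mem_compl_iff, hw, not_true_eq_false, not_false_eq_true,
        Set.indicator_of_notMem, norm_zero, mul_zero]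
      positivity
    · rw [Set.indicator_of_mem (show w ∈ Aᶜ from hw)]
      by_cases h0 : g w = 0
      · simp [h0]
      · exact mul_le_mul_of_nonneg_right (hB w hw h0) (norm_nonneg _)

lemma bub_norm (m : ℝ) (n : ℕ) (k₀ : ℝ)
    (hnorm : cylH1Norm m n (cylBubble m n k₀ 1 0) = 1) (t : ℝ) (ht : 0 < t)
    (x₀ : EuclideanSpace ℝ (Fin n)) :
    ‖(bub_all m n k₀ hnorm t ht x₀).1.toLp‖ = 1 := by
  have h := (normsq_toLp (bub_all m n k₀ hnorm t ht x₀).1).trans (bub_all m n k₀ hnorm t ht x₀).2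
  exact (pow_eq_one_iff_of_nonneg (norm_nonneg _) two_ne_zero).1 h

/-- Boundedness of the superlevel sets of the pairing. -/
lemma superlevel_bounded (m : ℝ) (n : ℕ) (hm : 0 < m) (hg : 0 < gammaExp m n)
    (k₀ : ℝ) (hk₀ : 0 < k₀)
    (hnorm : cylH1Norm m n (cylBubble m n k₀ 1 0) = 1)
    (G : ℝ × EuclideanSpace ℝ (Fin n) → EuclideanSpace ℂ (Option (Fin n)))
    (hGc : Continuous G) (hGs : HasCompactSupport G) (hG : MemLp G 2 (cylMeasure m n))
    (ε : ℝ) (hε : 0 < ε) :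
    Bornology.IsBounded {p : ℝ × EuclideanSpace ℝ (Fin n) |
      ε ≤ ‖(inner ℂ ((bub_all m n k₀ hnorm (Real.exp p.1) (Real.exp_pos _) p.2).1.toLp)
        (hG.toLp G) : ℂ)‖} := by
  have := cylMeasure_finite m n hm
  have hf1 : ∀ p : ℝ × EuclideanSpace ℝ (Fin n),
      ‖(bub_all m n k₀ hnorm (Real.exp p.1) (Real.exp_pos _) p.2).1.toLp‖ = 1 := by
    exact fun p => bub_norm m n k₀ hnorm _ (Real.exp_pos _) _
  have hG1 : Integrable G (cylMeasure m n) := hGc.integrable_of_hasCompactSupport hGs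
  have hGsq : Integrable (fun w => ‖G w‖ ^ 2) (cylMeasure m n) :=
    (memLp_two_iff_integrable_sq_norm hG.1).1 hG
  set I := ∫ w, ‖G w‖ ∂(cylMeasure m n) with hI
  have hI0 : 0 ≤ I := integral_nonneg (fun w => norm_nonneg _)
  set g := gammaExp m n with hgdef
  obtain ⟨η, hη, hηs⟩ := exists_eta m n _ hGsq ((ε / 2) ^ 2) (by positivity)
  obtain ⟨R, hR, hsR⟩ := hGs.isCompact.isBounded.subset_closedBall_lt 0 0
  -- large t
  have hlim1 : Filter.Tendsto (fun s : ℝ => 2 * g * k₀ * Real.exp s ^ (-g)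
      * η ^ (-(2 * g + 1)) * I) Filter.atTop (nhds 0) := by
    have := (tendsto_rpow_neg_atTop hg).comp Real.tendsto_exp_atTop
    simpa using (((this.const_mul (2 * g * k₀)).mul_const (η ^ (-(2 * g + 1)))).mul_const I)
  obtain ⟨S1, hS1⟩ := Filter.eventually_atTop.1 (hlim1.eventually (gt_mem_nhds (half_pos hε)))
  -- small t
  have hlim2 : Filter.Tendsto (fun s : ℝ => 2 * g * k₀ * Real.exp s ^ (g + 1) * I)
      Filter.atBot (nhds 0) := by
    have h1 : Filter.Tendsto (fun x : ℝ => x ^ (g + 1)) (nhds 0) (nhds 0) := by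
      have := (Real.continuousAt_rpow_const 0 (g + 1) (Or.inr (by linarith))).tendsto
      rwa [Real.zero_rpow (by linarith)] at this
    have := h1.comp Real.tendsto_exp_atBot
    simpa using ((this.const_mul (2 * g * k₀)).mul_const I)
  obtain ⟨S2, hS2⟩ := Filter.eventually_atBot.1 (hlim2.eventually (gt_mem_nhds hε))
  -- far x₀
  have hlim3 : Filter.Tendsto (fun r : ℝ => 2 * g * k₀ * Real.exp S2 ^ (-g)
      * (r - R) ^ (-(2 * g + 1)) * I) Filter.atTop (nhds 0) := by
    have := (tendsto_rpow_neg_atTop (y := 2 * g + 1) (by linarith)).comp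
      (Filter.tendsto_atTop_add_const_right Filter.atTop (-R) Filter.tendsto_id)
    simpa [← sub_eq_add_neg, Function.comp_def] using
      ((this.const_mul (2 * g * k₀ * Real.exp S2 ^ (-g))).mul_const I)
  obtain ⟨R1, hR1⟩ := Filter.eventually_atTop.1 (hlim3.eventually (gt_mem_nhds hε))
  refine ((Metric.isBounded_Icc S2 S1).prod
    (Metric.isBounded_closedBall (x := (0 : EuclideanSpace ℝ (Fin n))) (r := max R1 (R + 1)))).subset
    ?_
  rintro ⟨s, x⟩ hp
  simp only [Set.mem_ofPred_eq] at hp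
  have hes := Real.exp_pos s
  have hs2 : S2 ≤ s := by
    by_contra! hlt
    have hb := inner_bound (bub_all m n k₀ hnorm (Real.exp s) hes x).1 hG hG1 (hf1 (s, x))
      ∅ MeasurableSet.empty (2 * g * k₀ * Real.exp s ^ (g + 1)) (by positivity)
      (fun w _ _ => bubGrad_small m n k₀ _ hes hk₀ hg x w) 0 le_rfl (by simp)
    linarith [hS2 s hlt.le]
  have hs1 : s ≤ S1 := by
    by_contra! hlt
    have hb := inner_bound (bub_all m n k₀ hnorm (Real.exp s) hes x).1 hG hG1 (hf1 (s, x))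
      {w | w.1 < η} (measurableSet_lt measurable_fst measurable_const)
      (2 * g * k₀ * Real.exp s ^ (-g) * η ^ (-(2 * g + 1))) (by positivity)
      (fun w hw _ => bubGrad_far m n k₀ _ hes hk₀ hg x w η hη (by
        simp only [Set.mem_ofPred_eq, not_lt] at hw
        refine hw.trans (le_of_abs_le (abs_le_of_sq_le_sq ?_ (norm_nonneg _)))
        rw [uvec_norm_sq]; nlinarith [sq_nonneg ‖w.2 - x‖])) (ε / 2) (by positivity) hηs.le
    linarith [hS1 s hlt.le]
  refine ⟨⟨hs2, hs1⟩, ?_⟩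
  simp only [Metric.mem_closedBall, dist_zero_right]
  by_contra! hlt
  have hxR1 : R1 ≤ ‖x‖ := (le_max_left _ _).trans hlt.le
  have hxR : R + 1 ≤ ‖x‖ := (le_max_right _ _).trans hlt.le
  have hpos : 0 < ‖x‖ - R := by linarith
  have hb := inner_bound (bub_all m n k₀ hnorm (Real.exp s) hes x).1 hG hG1 (hf1 (s, x))
      ∅ MeasurableSet.empty (2 * g * k₀ * Real.exp s ^ (-g) * (‖x‖ - R) ^ (-(2 * g + 1)))
      (by positivity)
      (fun w _ hw => bubGrad_far m n k₀ _ hes hk₀ hg x w (‖x‖ - R) hpos (by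
        have hwR : ‖w‖ ≤ R := by simpa using hsR (subset_tsupport G hw)
        have h2 : ‖w.2‖ ≤ R := (norm_snd_le w).trans hwR
        have h3 : ‖x‖ - R ≤ ‖w.2 - x‖ := by
          have := norm_sub_norm_le x w.2
          rw [norm_sub_rev] at this
          linarith
        refine h3.trans (le_of_abs_le (abs_le_of_sq_le_sq ?_ (norm_nonneg _)))
        rw [uvec_norm_sq]; nlinarith [sq_nonneg w.1])) 0 le_rfl (by simp)
  have hmono : Real.exp s ^ (-g) ≤ Real.exp S2 ^ (-g) :=
    Real.rpow_le_rpow_of_nonpos (Real.exp_pos _) (Real.exp_le_exp.2 hs2) (by linarith)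
  have hmono2 : 2 * g * k₀ * Real.exp s ^ (-g) * (‖x‖ - R) ^ (-(2 * g + 1)) * I ≤
      2 * g * k₀ * Real.exp S2 ^ (-g) * (‖x‖ - R) ^ (-(2 * g + 1)) * I := by gcongr
  linarith [hR1 ‖x‖ hxR1]

lemma pairing_cont (m : ℝ) (n : ℕ) (hm : 0 < m) (k₀ : ℝ)
    (hnorm : cylH1Norm m n (cylBubble m n k₀ 1 0) = 1)
    (G : ℝ × EuclideanSpace ℝ (Fin n) → EuclideanSpace ℂ (Option (Fin n)))
    (hGc : Continuous G) (hGs : HasCompactSupport G) (hG : MemLp G 2 (cylMeasure m n)) :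
    Continuous (fun p : ℝ × EuclideanSpace ℝ (Fin n) =>
      (inner ℂ ((bub_all m n k₀ hnorm (Real.exp p.1) (Real.exp_pos _) p.2).1.toLp)
        (hG.toLp G) : ℂ)) := by
  have := cylMeasure_finite m n hm
  simp_rw [inner_toLp]
  rw [← continuousOn_univ]
  refine continuousOn_integral_of_compact_support (k := tsupport G) hGs.isCompact ?_ ?_
  · apply Continuous.continuousOn
    exact (bubGrad_cont m n k₀).inner (hGc.comp continuous_snd)
  · intro p w _ hw
    rw [image_eq_zero_of_notMem_tsupport hw, inner_zero_right]

lemma proj_le {H : Type*} [NormedAddCommGroup H] [InnerProductSpace ℂ H] (Φ f : H)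
    (hf : ‖f‖ = 1) (z : ℂ) :
    ‖Φ - z • f‖ ^ 2 = ‖Φ‖ ^ 2 - ‖(inner ℂ f Φ : ℂ)‖ ^ 2 + ‖z - inner ℂ f Φ‖ ^ 2 := by
  set c : ℂ := inner ℂ f Φ with hc
  have h1 := norm_sub_sq (𝕜 := ℂ) Φ (z • f)
  have h2 := norm_sub_sq (𝕜 := ℂ) z c
  have h3 : (inner ℂ Φ (z • f) : ℂ) = z * (starRingEnd ℂ) c := by
    rw [inner_smul_right, hc, inner_conj_symm]
  have h4 : RCLike.re (inner ℂ z c : ℂ) = RCLike.re (z * (starRingEnd ℂ) c) := by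
    simp [mul_comm]
  rw [h1, h2, h3, h4, norm_smul, hf]
  ring

/-- **Attainment of the distance to the manifold of extremals.** If `φ` is smooth,
compactly supported, and `δ(φ,M) < ‖φ‖_{Ḣ¹}`, then the infimum defining `δ(φ,M)` is
attained: there are `z ∈ ℂ`, `t > 0`, `x₀ ∈ ℝⁿ` with `‖φ − z F_{t,x₀}‖_{Ḣ¹} = δ(φ,M)`. -/
theorem dist_to_extremals_attained (m : ℝ) (n : ℕ) (hm : 0 < m) (hn : 1 ≤ n)
    (hmn : 2 < m + n) (k₀ : ℝ) (hk₀ : 0 < k₀)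
    (hnorm : cylH1Norm m n (cylBubble m n k₀ 1 0) = 1)
    (φ : ℝ × EuclideanSpace ℝ (Fin n) → ℂ)
    (hφ_smooth : ContDiff ℝ (⊤ : ℕ∞) φ) (hφ_supp : HasCompactSupport φ)
    (hδ : cylDeltaM m n k₀ φ < cylH1Norm m n φ) :
    ∃ (z : ℂ) (t : ℝ) (x₀ : EuclideanSpace ℝ (Fin n)), 0 < t ∧
      cylH1Norm m n (fun w => φ w - z • cylBubble m n k₀ t x₀ w) =
        cylDeltaM m n k₀ φ := by
  have hg : 0 < gammaExp m n := by unfold gammaExp; linarith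
  have hfin := cylMeasure_finite m n hm
  have hGc := cylGrad_cont n φ hφ_smooth
  have hGs := cylGrad_supp n φ hφ_supp
  have hG : MemLp (cylGrad n φ) 2 (cylMeasure m n) := hGc.memLp_of_hasCompactSupport hGs
  have hB := fun (t : ℝ) (ht : 0 < t) x => (bub_all m n k₀ hnorm t ht x).1
  have hf1 : ∀ t (ht : 0 < t) x, ‖(hB t ht x).toLp‖ = 1 := by
    exact fun t ht x => bub_norm m n k₀ hnorm t ht x
  have hφn := cylH1Norm_eq m n φ hG
  have hkey : ∀ (z : ℂ) t (ht : 0 < t) x,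
      cylH1Norm m n (fun w => φ w - z • cylBubble m n k₀ t x w)
        = ‖hG.toLp - z • (hB t ht x).toLp‖ := by
    intro z t ht x
    have e : cylGrad n (fun w => φ w - z • cylBubble m n k₀ t x w)
        = cylGrad n φ - z • bubGrad m n k₀ t x := by
      funext w
      have hd1 : DifferentiableAt ℝ φ w := (hφ_smooth.differentiable (by simp)) w
      have hd2 := (bubble_hasFDerivAt m n k₀ t ht x w).differentiableAt
      rw [Pi.sub_apply, Pi.smul_apply, ← bubble_grad m n k₀ t ht x w]
      unfold cylGrad
      have e2 : fderiv ℝ (fun w => φ w - z • cylBubble m n k₀ t x w) w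
          = fderiv ℝ φ w - z • fderiv ℝ (cylBubble m n k₀ t x) w :=
        (hd1.hasFDerivAt.sub (hd2.hasFDerivAt.const_smul z)).fderiv
      rw [e2]
      ext i
      simp
    have hm' : MemLp (cylGrad n (fun w => φ w - z • cylBubble m n k₀ t x w)) 2
        (cylMeasure m n) := by
      rw [e]; exact hG.sub ((hB t ht x).const_smul z)
    rw [cylH1Norm_eq m n _ hm', ← MemLp.toLp_const_smul, ← MemLp.toLp_sub]
    congr 2
  have hsq : ∀ (z : ℂ) t (ht : 0 < t) x,
      cylH1Norm m n (fun w => φ w - z • cylBubble m n k₀ t x w) ^ 2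
        = ‖hG.toLp‖ ^ 2 - ‖(inner ℂ (hB t ht x).toLp hG.toLp : ℂ)‖ ^ 2
          + ‖z - inner ℂ (hB t ht x).toLp hG.toLp‖ ^ 2 := by
    intro z t ht x
    rw [hkey z t ht x, proj_le _ _ (hf1 t ht x)]
  have hnn : ∀ ψ, 0 ≤ cylH1Norm m n ψ := fun ψ => Real.sqrt_nonneg _
  have hex : ∃ p : ℝ × EuclideanSpace ℝ (Fin n),
      0 < ‖(inner ℂ (hB (Real.exp p.1) (Real.exp_pos _) p.2).toLp hG.toLp : ℂ)‖ := by
    by_contra! hcon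
    refine absurd hδ (not_lt.2 ?_)
    unfold cylDeltaM
    have : Nonempty (ℂ × {t : ℝ // 0 < t} × EuclideanSpace ℝ (Fin n)) :=
      ⟨(0, ⟨1, one_pos⟩, 0)⟩
    refine le_ciInf ?_
    rintro ⟨z, ⟨t, ht⟩, x⟩
    refine le_of_abs_le (abs_le_of_sq_le_sq ?_ (hnn _))
    have h := hcon (Real.log t, x)
    simp only [Real.exp_log ht] at h
    have h0 : ‖(inner ℂ (hB t ht x).toLp hG.toLp : ℂ)‖ = 0 := le_antisymm h (norm_nonneg _)
    rw [hsq z t ht x, h0, hφn]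
    nlinarith [sq_nonneg ‖z - inner ℂ (hB t ht x).toLp hG.toLp‖]
  obtain ⟨p0, hp0⟩ := hex
  obtain ⟨p, hp⟩ := (pairing_cont m n hm k₀ hnorm _ hGc hGs hG).norm.exists_forall_ge_of_isBounded
    p0 (superlevel_bounded m n hm hg k₀ hk₀ hnorm _ hGc hGs hG _ hp0)
  refine ⟨inner ℂ (hB (Real.exp p.1) (Real.exp_pos _) p.2).toLp hG.toLp, Real.exp p.1, p.2,
    Real.exp_pos _, le_antisymm ?_ ?_⟩
  · unfold cylDeltaM
    have : Nonempty (ℂ × {t : ℝ // 0 < t} × EuclideanSpace ℝ (Fin n)) :=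
      ⟨(0, ⟨1, one_pos⟩, 0)⟩
    refine le_ciInf ?_
    rintro ⟨z, ⟨t, ht⟩, x⟩
    refine le_of_abs_le (abs_le_of_sq_le_sq ?_ (hnn _))
    have h := hp (Real.log t, x)
    simp only [Real.exp_log ht] at h
    rw [hsq _ _ (Real.exp_pos _), hsq z t ht x, sub_self, norm_zero]
    have h2 := pow_le_pow_left₀ (norm_nonneg _) h 2
    nlinarith [sq_nonneg ‖z - inner ℂ (hB t ht x).toLp hG.toLp‖]
  · unfold cylDeltaM
    exact ciInf_le (f := fun p : ℂ × {t : ℝ // 0 < t} × EuclideanSpace ℝ (Fin n) =>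
      cylH1Norm m n (fun w => φ w - p.1 • cylBubble m n k₀ p.2.1.1 p.2.2 w))
      ⟨0, by rintro _ ⟨q, rfl⟩; exact hnn _⟩
      (inner ℂ (hB (Real.exp p.1) (Real.exp_pos _) p.2).toLp hG.toLp,
        ⟨Real.exp p.1, Real.exp_pos _⟩, p.2)
end
end

section
/- Let m > 0 be a real number and n ≥ 1 an integer with N := m + n > 2. Let g : (0,∞) × ℝⁿ → ℝ be given by g(ρ,x) = (1 + ρ² + |x|²)^{−(N−2)/2}. Then for all ρ > 0 and x ∈ ℝⁿ: −Δ_x g(ρ,x) − ∂²_ρ g(ρ,x) − ((m−1)/ρ) ∂_ρ g(ρ,x) = N(N−2) · g(ρ,x)^{(N+2)/(N−2)}, where Δ_x is the Laplacian in the x variables. -/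
open MeasureTheory

noncomputable section

/-- The profile `g(ρ,x) = (1 + ρ² + |x|²)^{−(N−2)/2}` with `N = m + n`. -/
def elProfile (m : ℝ) (n : ℕ) (ρ : ℝ) (x : EuclideanSpace ℝ (Fin n)) : ℝ :=
  (1 + ρ ^ 2 + ‖x‖ ^ 2) ^ (-((m + n - 2) / 2))

lemma el_d1 (c b p : ℝ) (h : ∀ s : ℝ, 0 < c + (s + b) ^ 2) :
    deriv (fun s : ℝ => (c + (s + b) ^ 2) ^ p) =
      fun s => 2 * p * ((s + b) * (c + (s + b) ^ 2) ^ (p - 1)) := by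
  funext s
  have h1 : HasDerivAt (fun s : ℝ => c + (s + b) ^ 2) (2 * (s + b)) s := by
    have := (((hasDerivAt_id s).add_const b).pow 2).const_add c
    simpa using this
  rw [(h1.rpow_const (p := p) (Or.inl (h s).ne')).deriv]
  ring

lemma el_d2 (c b p s : ℝ) (h : ∀ s : ℝ, 0 < c + (s + b) ^ 2) :
    iteratedDeriv 2 (fun s : ℝ => (c + (s + b) ^ 2) ^ p) s =
      2 * p * (c + (s + b) ^ 2) ^ (p - 1)
        + 4 * p * (p - 1) * (s + b) ^ 2 * (c + (s + b) ^ 2) ^ (p - 2) := by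
  rw [iteratedDeriv_succ, iteratedDeriv_one, el_d1 c b p h]
  have h1 : HasDerivAt (fun s : ℝ => c + (s + b) ^ 2) (2 * (s + b)) s := by
    have := (((hasDerivAt_id s).add_const b).pow 2).const_add c
    simpa using this
  have h2 := h1.rpow_const (p := p - 1) (Or.inl (h s).ne')
  have h3 : HasDerivAt (fun s : ℝ => s + b) 1 s := (hasDerivAt_id s).add_const b
  have h4 := (h3.mul h2).const_mul (2 * p)
  refine h4.deriv.trans ?_
  rw [show p - 1 - 1 = p - 2 by ring]
  ring

/-- **Euler–Lagrange equation for the continuous-dimension Sobolev extremal.**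
With `N = m + n > 2`, `g(ρ,x) = (1 + ρ² + |x|²)^{−(N−2)/2}` satisfies
`−Δ_x g − ∂²_ρ g − ((m−1)/ρ) ∂_ρ g = N(N−2) g^{(N+2)/(N−2)}` for all `ρ > 0, x ∈ ℝⁿ`. -/
theorem extremal_euler_lagrange (m : ℝ) (n : ℕ) (hm : 0 < m) (hn : 1 ≤ n)
    (hmn : 2 < m + n) (ρ : ℝ) (hρ : 0 < ρ) (x : EuclideanSpace ℝ (Fin n)) :
    -(∑ i : Fin n,
          iteratedDeriv 2 (fun s : ℝ => elProfile m n ρ (x + s • EuclideanSpace.single i 1)) 0) -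
        iteratedDeriv 2 (fun r : ℝ => elProfile m n r x) ρ -
        ((m - 1) / ρ) * deriv (fun r : ℝ => elProfile m n r x) ρ =
      (m + n) * (m + n - 2) *
        elProfile m n ρ x ^ ((m + n + 2) / (m + n - 2)) := by
  set p : ℝ := -((m + n - 2) / 2) with hp
  set Q : ℝ := 1 + ρ ^ 2 + ‖x‖ ^ 2 with hQ
  have hQpos : 0 < Q := by positivity
  have hxs : ‖x‖ ^ 2 = ∑ i, x i ^ 2 := EuclideanSpace.real_norm_sq_eq x
  have hx : ∀ i : Fin n,
      iteratedDeriv 2 (fun s : ℝ => elProfile m n ρ (x + s • EuclideanSpace.single i 1)) 0 =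
        2 * p * Q ^ (p - 1) + 4 * p * (p - 1) * x i ^ 2 * Q ^ (p - 2) := by
    intro i
    have hle : x i ^ 2 ≤ ‖x‖ ^ 2 := by
      rw [hxs]
      exact Finset.single_le_sum (f := fun j => x j ^ 2) (fun j _ => sq_nonneg _)
        (Finset.mem_univ i)
    have hf : (fun s : ℝ => elProfile m n ρ (x + s • EuclideanSpace.single i 1)) =
        fun s => ((Q - x i ^ 2) + (s + x i) ^ 2) ^ p := by
      funext s
      unfold elProfile
      rw [← hp]
      congr 1
      rw [norm_add_sq_real, norm_smul, inner_smul_right, EuclideanSpace.inner_single_right]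
      simp [hQ]
      ring
    rw [hf, el_d2 _ _ _ _ (fun s => by nlinarith [sq_nonneg (s + x i), sq_nonneg ρ])]
    rw [zero_add, sub_add_cancel]
  have hf : (fun r : ℝ => elProfile m n r x) = fun r => ((1 + ‖x‖ ^ 2) + (r + 0) ^ 2) ^ p := by
    funext r
    unfold elProfile
    rw [← hp]
    congr 1
    ring
  have hpos : ∀ s : ℝ, 0 < (1 + ‖x‖ ^ 2) + (s + 0) ^ 2 := fun s => by positivity
  have hQ2 : (1 + ‖x‖ ^ 2) + (ρ + 0) ^ 2 = Q := by rw [hQ]; ring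
  rw [Finset.sum_congr rfl (fun i _ => hx i), hf, el_d2 _ _ _ _ hpos, el_d1 _ _ _ hpos]
  simp only [hQ2]
  have hR : elProfile m n ρ x ^ ((m + n + 2) / (m + n - 2)) = Q ^ (p - 2) := by
    unfold elProfile
    rw [← hp, ← hQ, ← Real.rpow_mul hQpos.le]
    congr 1
    have : m + n - 2 ≠ 0 := by linarith
    rw [hp]
    field_simp
    ring
  have hQ1 : Q ^ (p - 1) = Q * Q ^ (p - 2) := by
    rw [show p - 1 = 1 + (p - 2) by ring, Real.rpow_add hQpos, Real.rpow_one]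
  rw [hR, hQ1, Finset.sum_add_distrib, Finset.sum_const, ← Finset.sum_mul, ← Finset.mul_sum, ← hxs]
  simp only [Finset.card_univ, Fintype.card_fin, nsmul_eq_mul]
  generalize Q ^ (p - 2) = T
  have hX : ‖x‖ ^ 2 = Q - 1 - ρ ^ 2 := by rw [hQ]; ring
  rw [hX, hp]
  field_simp
  ring
end
end

section
/- Let m > 0 and n > 0 be real numbers, and let g : (0, π/2) → ℝ be given by g(θ) = (n−m)/(m+n) + cos(2θ). Then for every θ ∈ (0, π/2): −g''(θ) − ((n−1)·cot(θ) − (m−1)·tan(θ)) · g'(θ) = 2(m+n) · g(θ). -/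
open Real

noncomputable section

/-- **The angular eigenfunction.** For real `m, n > 0`, the function
`g(θ) = (n−m)/(m+n) + cos(2θ)` satisfies
`−g'' − ((n−1)cot θ − (m−1)tan θ) g' = 2(m+n) g` on `(0, π/2)`. -/
theorem angular_eigenfunction (m n : ℝ) (hm : 0 < m) (hn : 0 < n)
    (g : ℝ → ℝ) (hg : g = fun θ => (n - m) / (m + n) + Real.cos (2 * θ))
    (θ : ℝ) (hθ : θ ∈ Set.Ioo 0 (Real.pi / 2)) :
    -(deriv (deriv g) θ) -
        ((n - 1) * Real.cot θ - (m - 1) * Real.tan θ) * deriv g θ =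
      2 * (m + n) * g θ := by
  have hs : Real.sin θ ≠ 0 :=
    (Real.sin_pos_of_pos_of_lt_pi hθ.1 (by linarith [hθ.2, Real.pi_pos])).ne'
  have hc : Real.cos θ ≠ 0 :=
    (Real.cos_pos_of_mem_Ioo ⟨by linarith [hθ.1, Real.pi_pos], hθ.2⟩).ne'
  have hmn : m + n ≠ 0 := by positivity
  have h2 : ∀ x : ℝ, HasDerivAt (fun y : ℝ => 2 * y) 2 x := fun x => by
    simpa using (hasDerivAt_id x).const_mul (2 : ℝ)
  have h1 : deriv g = fun x => -Real.sin (2 * x) * 2 := by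
    funext x
    rw [hg]
    exact ((h2 x).cos.const_add _).deriv
  have h3 : deriv (deriv g) θ = -(Real.cos (2 * θ) * 2) * 2 := by
    rw [h1]
    exact ((h2 θ).sin.neg.mul_const 2).deriv
  rw [h3, h1, hg]
  simp only []
  have e1 : Real.cot θ * Real.sin (2 * θ) = 2 * Real.cos θ ^ 2 := by
    rw [Real.cot_eq_cos_div_sin, Real.sin_two_mul]
    field_simp
  have e2 : Real.tan θ * Real.sin (2 * θ) = 2 * Real.sin θ ^ 2 := by
    rw [Real.tan_eq_sin_div_cos, Real.sin_two_mul]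
    field_simp
  have e3 : (m + n) * ((n - m) / (m + n)) = n - m := by field_simp
  have e4 := Real.cos_two_mul θ
  have e5 := Real.sin_sq_add_cos_sq θ
  linear_combination 2 * (n - 1) * e1 - 2 * (m - 1) * e2 - 2 * e3
    + (4 - 2 * (m + n)) * e4 - 4 * (m - 1) * e5
end
end

section
/- Fix a real number m > 0 and an integer n ≥ 1 with m + n > 2, and let F(u) = k₀ 2^{−γ} cosh(u)^{−γ} for u ∈ ℝ. Suppose ξ : ℝ → ℝ is twice continuously differentiable and satisfies, for all u ∈ ℝ, C_{m,n}² (γ² ξ(u) − ξ''(u)) = (2* − 1) C_{m,n}^{2−2*} F(u)^{2*−2} ξ(u). If ξ is not a real scalar multiple of the derivative F' of F, then ∫_ℝ (γ² ξ(u)² + ξ'(u)²) du = +∞. -/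
open MeasureTheory

noncomputable section

lemma aux_phi_deriv (g u : ℝ) : HasDerivAt (fun u => Real.sinh u * Real.cosh u ^ (-g - 1))
    (Real.cosh u ^ (-g) - (g + 1) * Real.sinh u ^ 2 * Real.cosh u ^ (-g - 2)) u := by
  have hc := Real.cosh_pos u
  have h := (Real.hasDerivAt_sinh u).mul
    ((Real.hasDerivAt_cosh u).rpow_const (p := -g - 1) (Or.inl hc.ne'))
  refine h.congr_deriv ?_
  have e1 : Real.cosh u ^ (-g) = Real.cosh u ^ (-g - 1) * Real.cosh u := by
    rw [← Real.rpow_add_one hc.ne']; ring_nf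
  rw [e1, show -g - 1 - 1 = -g - 2 by ring]
  ring

lemma aux_phi_deriv2 (g u : ℝ) :
    HasDerivAt (fun u => Real.cosh u ^ (-g) - (g + 1) * Real.sinh u ^ 2 * Real.cosh u ^ (-g - 2))
    ((g ^ 2 - (g + 1) * (g + 2) * (Real.cosh u ^ 2)⁻¹) *
      (Real.sinh u * Real.cosh u ^ (-g - 1))) u := by
  have hc := Real.cosh_pos u
  have h := ((Real.hasDerivAt_cosh u).rpow_const (p := -g) (Or.inl hc.ne')).sub
    ((((Real.hasDerivAt_sinh u).pow 2).const_mul (g + 1)).mul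
    ((Real.hasDerivAt_cosh u).rpow_const (p := -g - 2) (Or.inl hc.ne')))
  refine h.congr_deriv ?_
  have e1 : Real.cosh u ^ (-g - 1) = Real.cosh u ^ (-g - 3) * Real.cosh u ^ 2 := by
    rw [← Real.rpow_natCast, ← Real.rpow_add hc]; norm_num; ring_nf
  have e2 : Real.cosh u ^ (-g - 2) = Real.cosh u ^ (-g - 3) * Real.cosh u := by
    rw [← Real.rpow_add_one hc.ne']; ring_nf
  have e3 : Real.sinh u ^ 2 = Real.cosh u ^ 2 - 1 := Real.sinh_sq u
  simp only [Nat.cast_ofNat, Pi.pow_apply, Nat.add_one_sub_one, pow_one]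
  rw [e1, e2, show -g - 2 - 1 = -g - 3 by ring, e3]
  field_simp
  ring

lemma aux_phi_bd (g u : ℝ) (hg : 0 < g) : (Real.sinh u * Real.cosh u ^ (-g - 1)) ^ 2 ≤ 1 := by
  have hc := Real.cosh_pos u
  have h1 := Real.one_le_cosh u
  have e1 : Real.cosh u ^ (-g - 1) = Real.cosh u ^ (-g) / Real.cosh u := by
    rw [Real.rpow_sub_one hc.ne']
  have h2 : Real.cosh u ^ (-g) ≤ 1 := Real.rpow_le_one_of_one_le_of_nonpos h1 (by linarith)
  have h3 : 0 < Real.cosh u ^ (-g) := Real.rpow_pos_of_pos hc _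
  have e3 : Real.sinh u ^ 2 = Real.cosh u ^ 2 - 1 := Real.sinh_sq u
  rw [e1, mul_pow, div_pow, e3, mul_div_assoc', div_le_one (by positivity)]
  have : (Real.cosh u ^ (-g)) ^ 2 ≤ 1 := by nlinarith
  nlinarith

lemma aux_phi'_bd (g u : ℝ) (hg : 0 < g) :
    (Real.cosh u ^ (-g) - (g + 1) * Real.sinh u ^ 2 * Real.cosh u ^ (-g - 2)) ^ 2 ≤
      (g + 2) ^ 2 := by
  have hc := Real.cosh_pos u
  have h1 := Real.one_le_cosh u
  have e1 : Real.cosh u ^ (-g - 2) = Real.cosh u ^ (-g) / Real.cosh u ^ 2 := by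
    rw [Real.rpow_sub hc]; norm_num
  have h2 : Real.cosh u ^ (-g) ≤ 1 := Real.rpow_le_one_of_one_le_of_nonpos h1 (by linarith)
  have h3 : 0 < Real.cosh u ^ (-g) := Real.rpow_pos_of_pos hc _
  have e3 : Real.sinh u ^ 2 = Real.cosh u ^ 2 - 1 := Real.sinh_sq u
  have h4 : 0 ≤ Real.sinh u ^ 2 * Real.cosh u ^ (-g - 2) := by positivity
  have h5 : Real.sinh u ^ 2 * Real.cosh u ^ (-g - 2) ≤ 1 := by
    rw [e1, e3, mul_div_assoc', div_le_one (by positivity)]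
    nlinarith
  rw [mul_assoc]
  apply sq_le_sq'
  · nlinarith
  · nlinarith

lemma aux_ode (g : ℝ) (hg : 0 < g) (ξ : ℝ → ℝ) (hξ : ContDiff ℝ 2 ξ)
    (hODE : ∀ u : ℝ, deriv (deriv ξ) u =
      (g ^ 2 - (g + 1) * (g + 2) * (Real.cosh u ^ 2)⁻¹) * ξ u)
    (hfin : ∫⁻ u : ℝ, ENNReal.ofReal (g ^ 2 * ξ u ^ 2 + deriv ξ u ^ 2) ≠ ⊤) :
    ∃ c : ℝ, ξ = fun u => c * (Real.sinh u * Real.cosh u ^ (-g - 1)) := by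
  have d1 : ∀ u, HasDerivAt ξ (deriv ξ u) u := fun u =>
    (hξ.differentiable (by norm_num)).differentiableAt.hasDerivAt
  have hξ' : ContDiff ℝ 1 (deriv ξ) := by
    have : ContDiff ℝ (1 + 1) ξ := by norm_num; exact hξ
    exact (contDiff_succ_iff_deriv.1 this).2.2
  have d2 : ∀ u, HasDerivAt (deriv ξ)
      ((g ^ 2 - (g + 1) * (g + 2) * (Real.cosh u ^ 2)⁻¹) * ξ u) u := fun u => by
    rw [← hODE]
    exact (hξ'.differentiable (by norm_num)).differentiableAt.hasDerivAt
  set φ : ℝ → ℝ := fun u => Real.sinh u * Real.cosh u ^ (-g - 1) with hφ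
  set ψ : ℝ → ℝ := fun u =>
    Real.cosh u ^ (-g) - (g + 1) * Real.sinh u ^ 2 * Real.cosh u ^ (-g - 2) with hψ
  have p1 : ∀ u, HasDerivAt φ (ψ u) u := aux_phi_deriv g
  have p2 : ∀ u, HasDerivAt ψ
      ((g ^ 2 - (g + 1) * (g + 2) * (Real.cosh u ^ 2)⁻¹) * φ u) u := aux_phi_deriv2 g
  have hW : ∀ u, HasDerivAt (fun u => ξ u * ψ u - deriv ξ u * φ u) 0 u := fun u => by
    refine (((d1 u).mul (p2 u)).sub ((d2 u).mul (p1 u))).congr_deriv ?_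
    ring
  have hWc : ∀ u, ξ u * ψ u - deriv ξ u * φ u = ξ 0 := fun u => by
    have := is_const_of_deriv_eq_zero (fun u => (hW u).differentiableAt)
      (fun u => (hW u).deriv) u 0
    simpa [hφ, hψ] using this
  have hbd : ∀ u, ξ 0 ^ 2 ≤ (2 * ((g + 2) ^ 2 / g ^ 2 + 1)) *
      (g ^ 2 * ξ u ^ 2 + deriv ξ u ^ 2) := fun u => by
    have b1 : φ u ^ 2 ≤ 1 := aux_phi_bd g u hg
    have b2 : ψ u ^ 2 ≤ (g + 2) ^ 2 := aux_phi'_bd g u hg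
    rw [← hWc u]
    have k1 : (2 * ((g + 2) ^ 2 / g ^ 2 + 1)) * (g ^ 2 * ξ u ^ 2 + deriv ξ u ^ 2) =
      2 * (g + 2) ^ 2 * ξ u ^ 2 + 2 * deriv ξ u ^ 2 +
      2 * ((g + 2) ^ 2 / g ^ 2) * deriv ξ u ^ 2 + 2 * g ^ 2 * ξ u ^ 2 := by
      field_simp; ring
    have k2 : 0 ≤ 2 * ((g + 2) ^ 2 / g ^ 2) * deriv ξ u ^ 2 := by positivity
    have k3 : 0 ≤ 2 * g ^ 2 * ξ u ^ 2 := by positivity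
    have k4 := mul_le_mul_of_nonneg_left b1 (sq_nonneg (deriv ξ u))
    have k5 := mul_le_mul_of_nonneg_left b2 (sq_nonneg (ξ u))
    nlinarith [sq_nonneg (ξ u * ψ u + deriv ξ u * φ u)]
  have h0 : ξ 0 = 0 := by
    by_contra hne
    apply hfin
    have hK : 0 < 2 * ((g + 2) ^ 2 / g ^ 2 + 1) := by positivity
    set K := 2 * ((g + 2) ^ 2 / g ^ 2 + 1)
    have hpos : 0 < ξ 0 ^ 2 / K := by positivity
    rw [eq_top_iff]
    calc (⊤ : ENNReal) = ∫⁻ u : ℝ, ENNReal.ofReal (ξ 0 ^ 2 / K) := by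
          rw [lintegral_const, Real.volume_univ, ENNReal.mul_top]
          simpa using hpos
      _ ≤ _ := by
          apply lintegral_mono
          intro u
          apply ENNReal.ofReal_le_ofReal
          rw [div_le_iff₀' hK]
          exact hbd u
  refine ⟨deriv ξ 0, ?_⟩
  set c := deriv ξ 0 with hc
  let v : ℝ → ℝ × ℝ → ℝ × ℝ := fun t p =>
    (p.2, (g ^ 2 - (g + 1) * (g + 2) * (Real.cosh t ^ 2)⁻¹) * p.1)
  let K : NNReal := Real.toNNReal (1 + g ^ 2 + (g + 1) * (g + 2))
  have hKv : (K : ℝ) = 1 + g ^ 2 + (g + 1) * (g + 2) := Real.coe_toNNReal _ (by positivity)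
  have hv : ∀ t, LipschitzOnWith K (v t) (Set.univ) := fun t => by
    apply LipschitzWith.lipschitzOnWith
    apply LipschitzWith.of_dist_le_mul
    intro p q
    have hq : |g ^ 2 - (g + 1) * (g + 2) * (Real.cosh t ^ 2)⁻¹| ≤
        1 + g ^ 2 + (g + 1) * (g + 2) := by
      have h1 := Real.one_le_cosh t
      have h2 : (Real.cosh t ^ 2)⁻¹ ≤ 1 := inv_le_one_of_one_le₀ (by nlinarith)
      have h3 : 0 ≤ (Real.cosh t ^ 2)⁻¹ := by positivity
      have h4 : 0 < (g + 1) * (g + 2) := by positivity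
      rw [abs_le]; constructor <;> nlinarith [sq_nonneg g]
    rw [hKv]
    rw [Prod.dist_eq (x := v t p)]
    have hd1 : dist p.1 q.1 ≤ dist p q := le_max_left _ _
    have hd2 : dist p.2 q.2 ≤ dist p q := le_max_right _ _
    have hd0 : 0 ≤ dist p q := dist_nonneg
    apply max_le
    · change dist p.2 q.2 ≤ _
      have : 0 ≤ (g ^ 2 + (g + 1) * (g + 2)) * dist p q := by positivity
      nlinarith
    · simp only [v]
      rw [Real.dist_eq, ← mul_sub, abs_mul]
      exact mul_le_mul hq hd1 (abs_nonneg _) (by positivity)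
  have key := ODE_solution_unique_univ (v := v) (K := K) (s := fun _ => Set.univ) (t₀ := 0)
    (f := fun u => (ξ u, deriv ξ u)) (g := fun u => (c * φ u, c * ψ u)) hv
    (fun t => ⟨(d1 t).prodMk (d2 t), trivial⟩)
    (fun t => ⟨by
      refine (((p1 t).const_mul c).prodMk ((p2 t).const_mul c)).congr_deriv ?_
      refine Prod.ext rfl ?_
      change c * _ = _ * (c * φ t)
      ring, trivial⟩)
    (by simp [hφ, hψ, h0, hc])
  funext u
  exact congrArg Prod.fst (congrFun key u)

lemma aux_scale (m : ℝ) (n : ℕ) (s l : ℝ) (hl : 0 < l)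
    (h1 : Integrable (fun z : ℝ × EuclideanSpace ℝ (Fin n) =>
      (1 + (z.1 ^ 2 + ‖z.2‖ ^ 2)) ^ (-s)) (cylMeasure m n))
    (h2 : Integrable (fun z : ℝ × EuclideanSpace ℝ (Fin n) =>
      (1 + l ^ 2 * (z.1 ^ 2 + ‖z.2‖ ^ 2)) ^ (-s)) (cylMeasure m n)) :
    ∫ z, (1 + l ^ 2 * (z.1 ^ 2 + ‖z.2‖ ^ 2)) ^ (-s) ∂(cylMeasure m n) =
      l ^ (-(m + n)) * ∫ z, (1 + (z.1 ^ 2 + ‖z.2‖ ^ 2)) ^ (-s) ∂(cylMeasure m n) := by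
  unfold cylMeasure at h1 h2 ⊢
  rw [integral_prod _ h1, integral_prod _ h2]
  have hmeas : Measurable (fun ρ : ℝ => ENNReal.ofReal (omegaConst m * ρ ^ (m - 1))) := by
    fun_prop
  have hfin : ∀ᵐ ρ ∂((volume : Measure ℝ).restrict (Set.Ioi 0)),
    ENNReal.ofReal (omegaConst m * ρ ^ (m - 1)) < ⊤ := by simp
  rw [integral_withDensity_eq_integral_toReal_smul hmeas hfin,
    integral_withDensity_eq_integral_toReal_smul hmeas hfin]
  set H : ℝ → ℝ := fun ρ => ∫ x : EuclideanSpace ℝ (Fin n), (1 + (ρ ^ 2 + ‖x‖ ^ 2)) ^ (-s) with hH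
  have e1 : ∀ ρ : ℝ, (∫ x : EuclideanSpace ℝ (Fin n), (1 + l ^ 2 * (ρ ^ 2 + ‖x‖ ^ 2)) ^ (-s)) =
      l ^ (-(n : ℝ)) * H (l * ρ) := fun ρ => by
    have := Measure.integral_comp_smul (volume : Measure (EuclideanSpace ℝ (Fin n)))
      (fun x => (1 + ((l * ρ) ^ 2 + ‖x‖ ^ 2)) ^ (-s)) l
    rw [finrank_euclideanSpace, Fintype.card_fin, abs_of_pos (by positivity)] at this
    rw [Real.rpow_neg hl.le, Real.rpow_natCast, ← smul_eq_mul, ← this]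
    congr 1; funext x
    rw [norm_smul, Real.norm_eq_abs, mul_pow, mul_pow, sq_abs]
    congr 1; ring
  have e2 : ∀ ρ ∈ Set.Ioi (0:ℝ), (ENNReal.ofReal (omegaConst m * ρ ^ (m - 1))).toReal •
      (∫ x : EuclideanSpace ℝ (Fin n), (1 + l ^ 2 * (ρ ^ 2 + ‖x‖ ^ 2)) ^ (-s)) =
      (l ^ (-(n : ℝ)) * l ^ (-(m - 1))) *
      ((fun r => (ENNReal.ofReal (omegaConst m * r ^ (m - 1))).toReal • H r) (l * ρ)) := by
    intro ρ hρ
    have hρ : 0 < ρ := hρ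
    simp only [smul_eq_mul]
    rw [e1, Real.mul_rpow hl.le hρ.le, ENNReal.toReal_ofReal', ENNReal.toReal_ofReal',
      Real.rpow_neg hl.le (m - 1)]
    have hp : 0 < l ^ (m - 1) := by positivity
    have : omegaConst m * (l ^ (m - 1) * ρ ^ (m - 1)) =
      l ^ (m - 1) * (omegaConst m * ρ ^ (m - 1)) := by ring
    have k : max (omegaConst m * (l ^ (m - 1) * ρ ^ (m - 1))) 0 =
        l ^ (m - 1) * max (omegaConst m * ρ ^ (m - 1)) 0 := by
      rw [this, mul_max_of_nonneg _ _ hp.le, mul_zero]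
    rw [k]
    field_simp
  rw [setIntegral_congr_fun measurableSet_Ioi e2, integral_const_mul,
    integral_comp_mul_left_Ioi
      (fun r => (ENNReal.ofReal (omegaConst m * r ^ (m - 1))).toReal • H r) _ hl, mul_zero, smul_eq_mul, ← mul_assoc]
  congr 1
  rw [← Real.rpow_neg_one, ← Real.rpow_add hl, ← Real.rpow_add hl]
  ring_nf

lemma aux_finite (m : ℝ) (n : ℕ) (hm : 0 < m) :
    cylMeasure m n (Set.Icc (-1) 1 ×ˢ Metric.closedBall 0 1) < ⊤ := by
  unfold cylMeasure
  rw [Measure.prod_prod]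
  apply ENNReal.mul_lt_top _ measure_closedBall_lt_top
  rw [withDensity_apply _ measurableSet_Icc, Measure.restrict_restrict measurableSet_Icc]
  have h : IntegrableOn (fun ρ : ℝ => omegaConst m * ρ ^ (m - 1)) (Set.Icc (-1) 1 ∩ Set.Ioi 0) := by
    have h0 := (intervalIntegral.intervalIntegrable_rpow' (a := 0) (b := 1)
      (r := m - 1) (by linarith)).const_mul (omegaConst m)
    rw [intervalIntegrable_iff_integrableOn_Ioc_of_le zero_le_one] at h0
    apply h0.mono_set
    rintro x ⟨⟨_, hx⟩, hx0⟩
    exact ⟨hx0, hx⟩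
  exact h.lintegral_lt_top

lemma aux_integrable (m : ℝ) (n : ℕ) (hm : 0 < m) (N : ℝ) (hN : 0 < N)
    (h : Integrable (fun z : ℝ × EuclideanSpace ℝ (Fin n) =>
      (z.1 ^ 2 + ‖z.2‖ ^ 2) * (1 + (z.1 ^ 2 + ‖z.2‖ ^ 2)) ^ (-N)) (cylMeasure m n)) :
    Integrable (fun z : ℝ × EuclideanSpace ℝ (Fin n) =>
      (1 + (z.1 ^ 2 + ‖z.2‖ ^ 2)) ^ (-N)) (cylMeasure m n) := by
  set S : Set (ℝ × EuclideanSpace ℝ (Fin n)) := Set.Icc (-1) 1 ×ˢ Metric.closedBall 0 1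
  have hS : MeasurableSet S := measurableSet_Icc.prod measurableSet_closedBall
  have hi : Integrable (S.indicator (fun _ => (1:ℝ))) (cylMeasure m n) := by
    rw [integrable_indicator_iff hS]
    exact integrableOn_const (aux_finite m n hm).ne
  refine (hi.add h).mono' ?_ ?_
  · apply Measurable.aestronglyMeasurable
    fun_prop
  · refine Filter.Eventually.of_forall fun z => ?_
    have hq : 0 ≤ z.1 ^ 2 + ‖z.2‖ ^ 2 := by positivity
    have hp : 0 < (1 + (z.1 ^ 2 + ‖z.2‖ ^ 2)) ^ (-N) := Real.rpow_pos_of_pos (by linarith) _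
    rw [Real.norm_of_nonneg hp.le]
    simp only [Pi.add_apply]
    by_cases hz : z ∈ S
    · rw [Set.indicator_of_mem hz]
      have : (1 + (z.1 ^ 2 + ‖z.2‖ ^ 2)) ^ (-N) ≤ 1 :=
        Real.rpow_le_one_of_one_le_of_nonpos (by linarith) (by linarith)
      nlinarith
    · rw [Set.indicator_of_notMem hz]
      have : 1 ≤ z.1 ^ 2 + ‖z.2‖ ^ 2 := by
        by_contra hlt
        push Not at hlt
        apply hz
        refine ⟨abs_le.1 ?_, ?_⟩
        · rw [← sq_le_one_iff_abs_le_one]; nlinarith [sq_nonneg ‖z.2‖]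
        · rw [mem_closedBall_zero_iff]; nlinarith [sq_nonneg z.1, norm_nonneg z.2]
      nlinarith

lemma aux_pohozaev (m : ℝ) (n : ℕ) (hm : 0 < m) (hmn : 2 < m + n)
    (h : Integrable (fun z : ℝ × EuclideanSpace ℝ (Fin n) =>
      (z.1 ^ 2 + ‖z.2‖ ^ 2) * (1 + (z.1 ^ 2 + ‖z.2‖ ^ 2)) ^ (-(m + n))) (cylMeasure m n)) :
    (m + n - 2) * ∫ z : ℝ × EuclideanSpace ℝ (Fin n),
      (z.1 ^ 2 + ‖z.2‖ ^ 2) * (1 + (z.1 ^ 2 + ‖z.2‖ ^ 2)) ^ (-(m + n)) ∂(cylMeasure m n) =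
    (m + n) * ∫ z : ℝ × EuclideanSpace ℝ (Fin n),
      (1 + (z.1 ^ 2 + ‖z.2‖ ^ 2)) ^ (-(m + n)) ∂(cylMeasure m n) := by
  have h0 := aux_integrable m n hm (m + n) (by linarith) h
  generalize hN : m + n = N at *
  set q : ℝ × EuclideanSpace ℝ (Fin n) → ℝ := fun z => z.1 ^ 2 + ‖z.2‖ ^ 2 with hq
  have hq0 : ∀ z, 0 ≤ q z := fun z => by simp only [hq]; positivity
  have hqm : Measurable q := by simp only [hq]; fun_prop
  change Integrable (fun z => q z * (1 + q z) ^ (-N)) _ at h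
  change Integrable (fun z => (1 + q z) ^ (-N)) _ at h0
  change (N - 2) * ∫ z, q z * (1 + q z) ^ (-N) ∂(cylMeasure m n) =
    N * ∫ z, (1 + q z) ^ (-N) ∂(cylMeasure m n)
  have hsplit : ∀ z, (1 + q z) ^ (-(N - 1)) = (1 + q z) ^ (-N) + q z * (1 + q z) ^ (-N) := by
    intro z
    have : 0 < 1 + q z := by linarith [hq0 z]
    rw [show -(N - 1) = -N + 1 by ring, Real.rpow_add_one this.ne']
    ring
  have hs1 : Integrable (fun z => (1 + q z) ^ (-(N - 1))) (cylMeasure m n) := by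
    simp_rw [hsplit]; exact h0.add h
  have hcomp : ∀ l : ℝ, 1 / 2 < l → ∀ p : ℝ, 0 ≤ p → ∀ z,
      (1 + l ^ 2 * q z) ^ (-p) ≤ 4 ^ p * (1 + q z) ^ (-p) := by
    intro l hl p hp z
    have h1 : (1 + q z) / 4 ≤ 1 + l ^ 2 * q z := by nlinarith [hq0 z, mul_nonneg (hq0 z) (by nlinarith : 0 ≤ l ^ 2 - 1 / 4)]
    have h2 := Real.rpow_le_rpow_of_nonpos (z := -p) (by have := hq0 z; positivity) h1 (by linarith)
    refine h2.trans (le_of_eq ?_)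
    rw [Real.div_rpow (by linarith [hq0 z]) (by norm_num), Real.rpow_neg (by norm_num : (0:ℝ) ≤ 4)]
    rw [div_inv_eq_mul, mul_comm]
  have hint : ∀ l : ℝ, 1 / 2 < l → Integrable (fun z => (1 + l ^ 2 * q z) ^ (-(N - 1))) (cylMeasure m n) := by
    intro l hl
    refine (hs1.const_mul (4 ^ (N - 1))).mono' ?_ ?_
    · apply Measurable.aestronglyMeasurable; fun_prop
    · refine Filter.Eventually.of_forall fun z => ?_
      rw [Real.norm_of_nonneg (Real.rpow_nonneg (by have := hq0 z; positivity) _)]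
      exact hcomp l hl _ (by linarith) z
  have hD := (hasDerivAt_integral_of_dominated_loc_of_deriv_le (μ := cylMeasure m n) (x₀ := (1:ℝ))
    (s := Set.Ioo (1/2 : ℝ) 2) (F := fun l z => (1 + l ^ 2 * q z) ^ (-(N - 1)))
    (F' := fun l z => (2 * l * q z) * (-(N - 1)) * (1 + l ^ 2 * q z) ^ (-N))
    (bound := fun z => (4 * (N - 1) * 4 ^ N) * (q z * (1 + q z) ^ (-N)))
    (Ioo_mem_nhds (by norm_num) (by norm_num))
    (Filter.Eventually.of_forall fun l => by
      apply Measurable.aestronglyMeasurable; fun_prop)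
    (hint 1 (by norm_num))
    (by apply Measurable.aestronglyMeasurable; fun_prop)
    (Filter.Eventually.of_forall fun z l hl => by
      have a1 := hcomp l hl.1 N (by linarith) z
      have a2 := hq0 z
      have l0 : 0 < l := by linarith [hl.1]
      have a3 : 0 ≤ (1 + l ^ 2 * q z) ^ (-N) := Real.rpow_nonneg (by positivity) _
      have a4 : 0 ≤ (1 + q z) ^ (-N) := Real.rpow_nonneg (by positivity) _
      have N1 : 0 < N - 1 := by linarith
      rw [Real.norm_eq_abs, abs_mul, abs_mul, abs_neg, abs_of_nonneg a3, abs_of_pos N1,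
        abs_of_nonneg (by positivity)]
      calc 2 * l * q z * (N - 1) * (1 + l ^ 2 * q z) ^ (-N)
          ≤ 2 * 2 * q z * (N - 1) * (4 ^ N * (1 + q z) ^ (-N)) := by
            gcongr
            exact hl.2.le
        _ = _ := by ring)
    (h.const_mul _)
    (Filter.Eventually.of_forall fun z l hl => by
      have l0 : 0 < l := by linarith [hl.1]
      have a2 := hq0 z
      have := ((((hasDerivAt_id l).pow 2).mul_const (q z)).const_add 1).rpow_const
        (p := -(N - 1)) (Or.inl (by simp; positivity))
      refine this.congr_deriv ?_
      rw [show -(N - 1) - 1 = -N by ring]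
      simp)).2
  have hE : (fun l : ℝ => ∫ z, (1 + l ^ 2 * q z) ^ (-(N - 1)) ∂(cylMeasure m n)) =ᶠ[nhds 1]
      fun l => l ^ (-N) * ∫ z, (1 + q z) ^ (-(N - 1)) ∂(cylMeasure m n) := by
    filter_upwards [Ioo_mem_nhds (show (1/2:ℝ) < 1 by norm_num) (show (1:ℝ) < 2 by norm_num)] with l hl
    have := aux_scale m n (N - 1) l (by linarith [hl.1]) hs1 (hint l hl.1)
    rw [hN] at this
    exact this
  have hD2 : HasDerivAt (fun l : ℝ => l ^ (-N) * ∫ z, (1 + q z) ^ (-(N - 1)) ∂(cylMeasure m n))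
      ((-N) * ∫ z, (1 + q z) ^ (-(N - 1)) ∂(cylMeasure m n)) 1 := by
    have := (Real.hasDerivAt_rpow_const (x := 1) (p := -N) (Or.inl one_ne_zero)).mul_const
      (∫ z, (1 + q z) ^ (-(N - 1)) ∂(cylMeasure m n))
    simpa using this
  have hu := (hE.hasDerivAt_iff.1 hD).unique hD2
  simp_rw [hsplit] at hu
  rw [integral_add h0 h] at hu
  have : ∀ z, 2 * 1 * q z * -(N - 1) * (1 + 1 ^ 2 * q z) ^ (-N) =
    (-2 * (N - 1)) * (q z * (1 + q z) ^ (-N)) := fun z => by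
      rw [one_pow, one_mul]; ring
  simp_rw [this] at hu
  rw [integral_const_mul] at hu
  linarith

lemma aux_grad (m : ℝ) (n : ℕ) (k₀ : ℝ) (z : ℝ × EuclideanSpace ℝ (Fin n)) :
    cylGradSq n (cylBubble m n k₀ 1 0) z = (4 * gammaExp m n ^ 2 * k₀ ^ 2) *
      ((z.1 ^ 2 + ‖z.2‖ ^ 2) * (1 + (z.1 ^ 2 + ‖z.2‖ ^ 2)) ^ (-(m + n))) := by
  set g := gammaExp m n with hg
  have hf : cylBubble m n k₀ 1 0 = fun z => ((k₀ * (1 + (z.1 ^ 2 + ‖z.2‖ ^ 2)) ^ (-g) : ℝ) : ℂ) := by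
    funext z
    simp [cylBubble, ← hg, add_assoc]
  have hpos : 0 < 1 + (z.1 ^ 2 + ‖z.2‖ ^ 2) := by positivity
  have d0 : HasFDerivAt (fun z : ℝ × EuclideanSpace ℝ (Fin n) => 1 + (z.1 ^ 2 + ‖z.2‖ ^ 2))
     _ z := ((hasFDerivAt_fst.pow 2).add (hasFDerivAt_snd.norm_sq)).const_add 1
  have d1 := (d0.rpow_const (p := -g) (Or.inl hpos.ne')).const_mul k₀
  have d2 := (Complex.ofRealCLM.hasFDerivAt).comp z d1
  have hfd := d2.fderiv
  have hv : ∀ v, ‖fderiv ℝ (cylBubble m n k₀ 1 0) z v‖ ^ 2 =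
      (4 * g ^ 2 * k₀ ^ 2) * (1 + (z.1 ^ 2 + ‖z.2‖ ^ 2)) ^ (-(m + n)) *
        (z.1 * v.1 + inner ℝ z.2 v.2) ^ 2 := by
    intro v
    have e : (1 + (z.1 ^ 2 + ‖z.2‖ ^ 2)) ^ (-(m + n)) =
      ((1 + (z.1 ^ 2 + ‖z.2‖ ^ 2)) ^ (-g - 1)) ^ 2 := by
      rw [← Real.rpow_mul_natCast hpos.le]
      congr 1
      rw [hg, gammaExp]; push_cast; ring
    rw [hf, e]
    have : fderiv ℝ (fun z : ℝ × EuclideanSpace ℝ (Fin n) => ((k₀ * (1 + (z.1 ^ 2 + ‖z.2‖ ^ 2)) ^ (-g) : ℝ) : ℂ)) z v =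
      ((k₀ * (-g * (1 + (z.1 ^ 2 + ‖z.2‖ ^ 2)) ^ (-g - 1) * (2 * (z.1 * v.1 + inner ℝ z.2 v.2))) : ℝ) : ℂ) := by
      refine (congrArg (fun L => L v) hfd).trans ?_
      simp
      ring
    rw [this, Complex.norm_real, Real.norm_eq_abs, sq_abs]
    ring
  unfold cylGradSq
  rw [hv]
  simp_rw [hv]
  rw [← Finset.mul_sum]
  simp only [inner_zero_right, mul_zero, zero_add, add_zero, mul_one]
  have hs : ∑ i : Fin n, (inner ℝ z.2 (EuclideanSpace.single i (1:ℝ))) ^ 2 = ‖z.2‖ ^ 2 := by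
    rw [EuclideanSpace.norm_sq_eq]
    congr 1; funext i
    simp [EuclideanSpace.inner_single_right]
  rw [hs]
  ring

theorem aux_const (m : ℝ) (n : ℕ) (hm : 0 < m)
    (hmn : 2 < m + n) (k₀ : ℝ) (hk₀ : 0 < k₀)
    (hnorm : cylH1Norm m n (cylBubble m n k₀ 1 0) = 1) :
    ∫ z, ‖cylBubble m n k₀ 1 0 z‖ ^ (twoStar m n) ∂(cylMeasure m n) =
      k₀ ^ (twoStar m n - 2) / (4 * gammaExp m n * (gammaExp m n + 1)) := by
  have hg : 0 < gammaExp m n := by unfold gammaExp; linarith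
  have hgN : m + n = 2 * gammaExp m n + 2 := by unfold gammaExp; ring
  have hgs : gammaExp m n * twoStar m n = m + n := by
    unfold gammaExp twoStar
    have : m + n - 2 ≠ 0 := by linarith
    field_simp
  have h1 : ∫ z, cylGradSq n (cylBubble m n k₀ 1 0) z ∂(cylMeasure m n) = 1 := by
    unfold cylH1Norm at hnorm
    rwa [Real.sqrt_eq_one] at hnorm
  simp_rw [aux_grad] at h1
  rw [integral_const_mul] at h1
  have hint : Integrable (fun z : ℝ × EuclideanSpace ℝ (Fin n) =>
      (z.1 ^ 2 + ‖z.2‖ ^ 2) * (1 + (z.1 ^ 2 + ‖z.2‖ ^ 2)) ^ (-(m + n))) (cylMeasure m n) := by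
    by_contra hni
    rw [integral_undef hni] at h1
    simp at h1
  have hP := aux_pohozaev m n hm hmn hint
  have hb : ∀ z, ‖cylBubble m n k₀ 1 0 z‖ ^ (twoStar m n) =
      k₀ ^ (twoStar m n) * (1 + (z.1 ^ 2 + ‖z.2‖ ^ 2)) ^ (-(m + n)) := by
    intro z
    have hpos : 0 < 1 + (z.1 ^ 2 + ‖z.2‖ ^ 2) := by positivity
    have : cylBubble m n k₀ 1 0 z =
        ((k₀ * (1 + (z.1 ^ 2 + ‖z.2‖ ^ 2)) ^ (-gammaExp m n) : ℝ) : ℂ) := by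
      simp [cylBubble, add_assoc]
    rw [this, Complex.norm_real, Real.norm_of_nonneg (by positivity),
      Real.mul_rpow hk₀.le (by positivity), ← Real.rpow_mul hpos.le, ← hgs, neg_mul]
  simp_rw [hb]
  rw [integral_const_mul]
  generalize (∫ z : ℝ × EuclideanSpace ℝ (Fin n),
      (z.1 ^ 2 + ‖z.2‖ ^ 2) * (1 + (z.1 ^ 2 + ‖z.2‖ ^ 2)) ^ (-(m + n)) ∂(cylMeasure m n)) = I at *
  generalize (∫ z : ℝ × EuclideanSpace ℝ (Fin n),
      (1 + (z.1 ^ 2 + ‖z.2‖ ^ 2)) ^ (-(m + n)) ∂(cylMeasure m n)) = J at *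
  rw [hgN] at hP
  generalize gammaExp m n = g at *
  rw [Real.rpow_sub hk₀, Real.rpow_two]
  have : J = (4 * g * (g + 1) * k₀ ^ 2)⁻¹ := by
    apply eq_inv_of_mul_eq_one_left
    linear_combination h1 - 2 * g * k₀ ^ 2 * hP
  rw [this]
  field_simp

/-- **Solutions of the linearized radial ODE independent of `F'` have infinite
energy.** With `F(u) = k₀ 2^{−γ} cosh(u)^{−γ}` and `C_{m,n} = ‖F_{1,0}‖_{2*}`, any
`C²` solution `ξ` of `C_{m,n}²(γ²ξ − ξ'') = (2*−1) C_{m,n}^{2−2*} F^{2*−2} ξ` on `ℝ`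
that is not a real multiple of `F'` satisfies `∫_ℝ (γ²ξ² + ξ'²) du = +∞`. -/
theorem linearized_ode_infinite_energy (m : ℝ) (n : ℕ) (hm : 0 < m) (hn : 1 ≤ n)
    (hmn : 2 < m + n) (k₀ : ℝ) (hk₀ : 0 < k₀)
    (hnorm : cylH1Norm m n (cylBubble m n k₀ 1 0) = 1)
    (F : ℝ → ℝ)
    (hF : F = fun u => k₀ * (2 : ℝ) ^ (-(gammaExp m n)) * Real.cosh u ^ (-(gammaExp m n)))
    (ξ : ℝ → ℝ) (hξ : ContDiff ℝ 2 ξ)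
    (hODE : ∀ u : ℝ,
      cylLpNorm m n (twoStar m n) (cylBubble m n k₀ 1 0) ^ 2 *
          (gammaExp m n ^ 2 * ξ u - deriv (deriv ξ) u) =
        (twoStar m n - 1) *
            cylLpNorm m n (twoStar m n) (cylBubble m n k₀ 1 0) ^ (2 - twoStar m n) *
          F u ^ (twoStar m n - 2) * ξ u)
    (hlin : ∀ c : ℝ, ξ ≠ fun u => c * deriv F u) :
    ∫⁻ u : ℝ, ENNReal.ofReal (gammaExp m n ^ 2 * ξ u ^ 2 + deriv ξ u ^ 2) = ⊤ := by
  by_contra hfin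
  have hg : 0 < gammaExp m n := by unfold gammaExp; linarith
  have hI := aux_const m n hm hmn k₀ hk₀ hnorm
  have hts : 0 < twoStar m n := by unfold twoStar; apply div_pos <;> linarith
  have hg2 : -gammaExp m n * (twoStar m n - 2) = -2 := by
    unfold gammaExp twoStar
    have : m + n - 2 ≠ 0 := by linarith
    field_simp
    ring
  have hg1 : twoStar m n - 1 = (gammaExp m n + 2) / gammaExp m n := by
    unfold gammaExp twoStar
    have : m + n - 2 ≠ 0 := by linarith
    field_simp
    ring
  have hIpos : 0 < k₀ ^ (twoStar m n - 2) / (4 * gammaExp m n * (gammaExp m n + 1)) := by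
    positivity
  have hC : cylLpNorm m n (twoStar m n) (cylBubble m n k₀ 1 0) =
      (k₀ ^ (twoStar m n - 2) / (4 * gammaExp m n * (gammaExp m n + 1))) ^ (1 / twoStar m n) := by
    unfold cylLpNorm; rw [hI]
  have hCpos : 0 < cylLpNorm m n (twoStar m n) (cylBubble m n k₀ 1 0) := by
    rw [hC]; positivity
  have hCs : cylLpNorm m n (twoStar m n) (cylBubble m n k₀ 1 0) ^ (twoStar m n) =
      k₀ ^ (twoStar m n - 2) / (4 * gammaExp m n * (gammaExp m n + 1)) := by
    rw [hC, ← Real.rpow_mul hIpos.le, one_div, inv_mul_cancel₀ hts.ne', Real.rpow_one]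
  have hFp : ∀ u, F u ^ (twoStar m n - 2) =
      k₀ ^ (twoStar m n - 2) / 4 * (Real.cosh u ^ 2)⁻¹ := by
    intro u
    have hc := Real.cosh_pos u
    rw [hF]
    simp only
    rw [Real.mul_rpow (by positivity) (by positivity), Real.mul_rpow hk₀.le (by positivity),
      ← Real.rpow_mul (by norm_num), ← Real.rpow_mul hc.le, hg2, Real.rpow_neg hc.le,
      Real.rpow_neg (by norm_num), Real.rpow_two, Real.rpow_two]
    ring
  have hode2 : ∀ u : ℝ, deriv (deriv ξ) u =
      (gammaExp m n ^ 2 - (gammaExp m n + 1) * (gammaExp m n + 2) *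
        (Real.cosh u ^ 2)⁻¹) * ξ u := by
    intro u
    have h := hODE u
    rw [Real.rpow_sub hCpos, hCs, hFp, hg1] at h
    generalize cylLpNorm m n (twoStar m n) (cylBubble m n k₀ 1 0) = C at *
    have hk : 0 < k₀ ^ (twoStar m n - 2) := by positivity
    have hc := Real.cosh_pos u
    norm_num at h
    generalize gammaExp m n = g at *
    generalize k₀ ^ (twoStar m n - 2) = K at *
    have h2 : C ^ 2 * (g ^ 2 * ξ u - deriv (deriv ξ) u) =
      C ^ 2 * ((g + 1) * (g + 2) * (Real.cosh u ^ 2)⁻¹ * ξ u) := by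
      rw [h]
      field_simp
    have h3 := mul_left_cancel₀ (pow_ne_zero 2 hCpos.ne') h2
    linear_combination -h3
  obtain ⟨c, hc⟩ := aux_ode _ hg ξ hξ hode2 hfin
  apply hlin (c / (k₀ * (2 : ℝ) ^ (-(gammaExp m n)) * (-gammaExp m n)))
  rw [hc]
  funext u
  have hd : HasDerivAt F (k₀ * (2 : ℝ) ^ (-(gammaExp m n)) *
      (Real.sinh u * (-gammaExp m n) * Real.cosh u ^ (-gammaExp m n - 1))) u := by
    rw [hF]
    exact ((Real.hasDerivAt_cosh u).rpow_const (Or.inl (Real.cosh_pos u).ne')).const_mul _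
  rw [hd.deriv]
  have h2 : (0:ℝ) < 2 ^ (-gammaExp m n) := by positivity
  field_simp
end
end

section
/- Let (X,μ) be a measure space, 1 < p < ∞, and let h₁, h₂ ∈ L^p(X,μ) with 0 < ‖h₁‖_p ≤ ‖h₂‖_p. Then: (i) if 1 < p ≤ 2, ‖h₁ + h₂‖_p ≤ ‖h₁‖_p + ‖h₂‖_p − ((p−1)‖h₁‖_p/4) · ‖ h₁/‖h₁‖_p − h₂/‖h₂‖_p ‖_p²; (ii) if 2 ≤ p < ∞, ‖h₁ + h₂‖_p ≤ ‖h₁‖_p + ‖h₂‖_p − (‖h₁‖_p/(p·2^{p−1})) · ‖ h₁/‖h₁‖_p − h₂/‖h₂‖_p ‖_p^p. -/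
open MeasureTheory

noncomputable section

/-- The `L^p(μ)` norm of a real-valued function. -/
def lpNormR {X : Type*} [MeasurableSpace X] (μ : Measure X) (p : ℝ) (h : X → ℝ) : ℝ :=
  (∫ x, |h x| ^ p ∂μ) ^ (1 / p)

lemma nn {X : Type*} [MeasurableSpace X] (μ : Measure X) (p : ℝ) (h : X → ℝ) :
    0 ≤ lpNormR μ p h :=
  Real.rpow_nonneg (integral_nonneg fun x => Real.rpow_nonneg (abs_nonneg _) _) _

lemma npow {X : Type*} [MeasurableSpace X] (μ : Measure X) (p : ℝ) (hp : 1 < p) (h : X → ℝ) :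
    lpNormR μ p h ^ p = ∫ x, |h x| ^ p ∂μ := by
  unfold lpNormR
  rw [← Real.rpow_mul (integral_nonneg fun x => Real.rpow_nonneg (abs_nonneg _) _),
    one_div_mul_cancel (by linarith), Real.rpow_one]

lemma neq {X : Type*} [MeasurableSpace X] (μ : Measure X) (p : ℝ) (hp : 1 < p) (h : X → ℝ)
    (hh : MemLp h (ENNReal.ofReal p) μ) :
    lpNormR μ p h = (eLpNorm h (ENNReal.ofReal p) μ).toReal := by
  have h0 : (0:ℝ) ≤ p := by linarith
  rw [hh.eLpNorm_eq_integral_rpow_norm (by simp; linarith) ENNReal.ofReal_ne_top,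
    ENNReal.toReal_ofReal_eq_iff.2]
  · simp [lpNormR, ENNReal.toReal_ofReal h0]
  · positivity

lemma nint {X : Type*} [MeasurableSpace X] (μ : Measure X) (p : ℝ) (hp : 1 < p) (h : X → ℝ)
    (hh : MemLp h (ENNReal.ofReal p) μ) : Integrable (fun x => |h x| ^ p) μ := by
  have h0 : (0:ℝ) ≤ p := by linarith
  have := hh.integrable_norm_rpow (by simp; linarith) ENNReal.ofReal_ne_top
  simpa [ENNReal.toReal_ofReal h0] using this

lemma nadd {X : Type*} [MeasurableSpace X] (μ : Measure X) (p : ℝ) (hp : 1 < p) (f g : X → ℝ)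
    (hf : MemLp f (ENNReal.ofReal p) μ) (hg : MemLp g (ENNReal.ofReal p) μ) :
    lpNormR μ p (fun x => f x + g x) ≤ lpNormR μ p f + lpNormR μ p g := by
  have h1 : (1 : ENNReal) ≤ ENNReal.ofReal p := by simpa using hp.le
  rw [neq μ p hp f hf, neq μ p hp g hg, neq μ p hp (fun x => f x + g x) (hf.add hg),
    ← ENNReal.toReal_add hf.2.ne hg.2.ne]
  exact ENNReal.toReal_mono (ENNReal.add_ne_top.2 ⟨hf.2.ne, hg.2.ne⟩)
    (eLpNorm_add_le hf.1 hg.1 h1)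

lemma nsmul' {X : Type*} [MeasurableSpace X] (μ : Measure X) (p : ℝ) (hp : 1 < p) (f : X → ℝ)
    (c : ℝ) (hc : 0 ≤ c) :
    lpNormR μ p (fun x => c * f x) = c * lpNormR μ p f := by
  unfold lpNormR
  have : ∀ x, |c * f x| ^ p = c ^ p * |f x| ^ p := fun x => by
    rw [abs_mul, abs_of_nonneg hc, Real.mul_rpow hc (abs_nonneg _)]
  simp_rw [this]
  rw [integral_const_mul, Real.mul_rpow (by positivity)
    (integral_nonneg fun x => Real.rpow_nonneg (abs_nonneg _) _), ← Real.rpow_mul hc,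
    mul_one_div_cancel (by linarith), Real.rpow_one]

/-- scalar Clarkson -/
lemma clark (p : ℝ) (hp : 2 ≤ p) (x y : ℝ) :
    |x + y| ^ p + |x - y| ^ p ≤ 2 ^ (p - 1) * (|x| ^ p + |y| ^ p) := by
  have key : ∀ z : ℝ, |z| ^ p = (z ^ 2) ^ (p / 2) := fun z => by
    rw [← sq_abs, ← Real.rpow_natCast, ← Real.rpow_mul (abs_nonneg _)]
    congr 1; push_cast; ring
  rw [key, key, key, key]
  have h1 := Real.add_rpow_le_rpow_add (sq_nonneg (x + y)) (sq_nonneg (x - y))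
    (p := p / 2) (by linarith)
  have h2 : (x ^ 2 + y ^ 2) ^ (p / 2) ≤
      2 ^ (p / 2 - 1) * ((x ^ 2) ^ (p / 2) + (y ^ 2) ^ (p / 2)) := by
    have := NNReal.coe_le_coe.2 (NNReal.rpow_add_le_mul_rpow_add_rpow
      (Real.toNNReal (x ^ 2)) (Real.toNNReal (y ^ 2)) (p := p / 2) (by linarith))
    push_cast at this
    rwa [Real.coe_toNNReal _ (sq_nonneg x), Real.coe_toNNReal _ (sq_nonneg y)] at this
  have h3 : (x + y) ^ 2 + (x - y) ^ 2 = 2 * (x ^ 2 + y ^ 2) := by ring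
  rw [h3, Real.mul_rpow (by norm_num) (by positivity)] at h1
  refine h1.trans ((mul_le_mul_of_nonneg_left h2 (by positivity)).trans_eq ?_)
  rw [← mul_assoc, ← Real.rpow_add (by norm_num)]
  congr 2; ring

lemma psi (p : ℝ) (hp : 1 < p) (hp2 : p ≤ 2) (x : ℝ) (hx : 0 ≤ x) (hx1 : x ≤ 1) :
    2 * (p - 1) * x ≤ (1 + x) ^ (p - 1) - (1 - x) ^ (p - 1) := by
  have hm : MonotoneOn (fun x : ℝ => (1 + x) ^ (p - 1) - (1 - x) ^ (p - 1) - 2 * (p - 1) * x)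
      (Set.Icc 0 1) := by
    have hd : ∀ x ∈ Set.Ioo (0:ℝ) 1, HasDerivAt
        (fun x : ℝ => (1 + x) ^ (p - 1) - (1 - x) ^ (p - 1) - 2 * (p - 1) * x)
        (1 * (p - 1) * (1 + x) ^ (p - 1 - 1) - (-1) * (p - 1) * (1 - x) ^ (p - 1 - 1)
          - 2 * (p - 1) * 1) x := by
      intro x hx
      have a1 := ((hasDerivAt_id x).const_add 1).rpow_const (p := p - 1)
        (Or.inl (by simp only [id]; linarith [hx.1]))
      have a2 := ((hasDerivAt_id x).const_sub 1).rpow_const (p := p - 1)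
        (Or.inl (by simp only [id]; linarith [hx.2]))
      exact (a1.sub a2).sub ((hasDerivAt_id x).const_mul (2 * (p - 1)))
    apply monotoneOn_of_deriv_nonneg (convex_Icc 0 1)
    · apply Continuous.continuousOn
      have : 0 ≤ p - 1 := by linarith
      exact (((continuous_const.add continuous_id).rpow_const fun _ => Or.inr this).sub
        ((continuous_const.sub continuous_id).rpow_const fun _ => Or.inr this)).sub
        (continuous_const.mul continuous_id)
    · rw [interior_Icc]
      exact fun x hx => (hd x hx).differentiableAt.differentiableWithinAt
    · rw [interior_Icc]
      intro x hx
      rw [(hd x hx).deriv]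
      have s0 : 0 < (1 + x) ^ (p - 1 - 1) := Real.rpow_pos_of_pos (by linarith [hx.1]) _
      have t0 : 0 < (1 - x) ^ (p - 1 - 1) := Real.rpow_pos_of_pos (by linarith [hx.2]) _
      have st : 1 ≤ (1 + x) ^ (p - 1 - 1) * (1 - x) ^ (p - 1 - 1) := by
        rw [← Real.mul_rpow (by linarith [hx.1]) (by linarith [hx.2])]
        apply Real.one_le_rpow_of_pos_of_le_one_of_nonpos
        · nlinarith [hx.1, hx.2]
        · nlinarith [hx.1, hx.2]
        · linarith
      have : 2 ≤ (1 + x) ^ (p - 1 - 1) + (1 - x) ^ (p - 1 - 1) := by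
        nlinarith [sq_nonneg ((1 + x) ^ (p - 1 - 1) - (1 - x) ^ (p - 1 - 1))]
      nlinarith
  have := hm (Set.left_mem_Icc.2 zero_le_one) ⟨hx, hx1⟩ hx
  simp at this
  linarith

lemma phi (p : ℝ) (hp : 1 < p) (hp2 : p ≤ 2) (x : ℝ) (hx : 0 ≤ x) (hx1 : x ≤ 1) :
    2 + p * (p - 1) * x ^ 2 ≤ (1 + x) ^ p + (1 - x) ^ p := by
  have hm : MonotoneOn (fun x : ℝ => (1 + x) ^ p + (1 - x) ^ p - p * (p - 1) * x ^ 2)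
      (Set.Icc 0 1) := by
    have hd : ∀ x ∈ Set.Ioo (0:ℝ) 1, HasDerivAt
        (fun x : ℝ => (1 + x) ^ p + (1 - x) ^ p - p * (p - 1) * x ^ 2)
        (1 * p * (1 + x) ^ (p - 1) + (-1) * p * (1 - x) ^ (p - 1)
          - p * (p - 1) * (2 * x)) x := by
      intro x hx
      have a1 := ((hasDerivAt_id x).const_add 1).rpow_const (p := p)
        (Or.inl (by simp only [id]; linarith [hx.1]))
      have a2 := ((hasDerivAt_id x).const_sub 1).rpow_const (p := p)
        (Or.inl (by simp only [id]; linarith [hx.2]))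
      have a3 : HasDerivAt (fun x : ℝ => x ^ 2) (2 * x) x := by simpa using hasDerivAt_pow 2 x
      exact (a1.add a2).sub (a3.const_mul (p * (p - 1)))
    apply monotoneOn_of_deriv_nonneg (convex_Icc 0 1)
    · apply Continuous.continuousOn
      have : 0 ≤ p := by linarith
      exact (((continuous_const.add continuous_id).rpow_const fun _ => Or.inr this).add
        ((continuous_const.sub continuous_id).rpow_const fun _ => Or.inr this)).sub
        (continuous_const.mul (continuous_id.pow 2))
    · rw [interior_Icc]
      exact fun x hx => (hd x hx).differentiableAt.differentiableWithinAt
    · rw [interior_Icc]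
      intro x hx
      rw [(hd x hx).deriv]
      have := psi p hp hp2 x hx.1.le hx.2.le
      nlinarith
  have := hm (Set.left_mem_Icc.2 zero_le_one) ⟨hx, hx1⟩ hx
  simp at this
  linarith

lemma two1 (p : ℝ) (hp : 1 < p) (hp2 : p ≤ 2) (a b : ℝ) (hb : 0 ≤ b) (hab : b ≤ a) :
    2 * (a ^ 2 + (p - 1) * b ^ 2) ^ (p / 2) ≤ |a + b| ^ p + |a - b| ^ p := by
  rcases (hb.trans hab).eq_or_lt with h | h
  · subst h
    have : b = 0 := le_antisymm hab hb
    subst this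
    simp [Real.zero_rpow (show p / 2 ≠ 0 by linarith), Real.zero_rpow (show p ≠ 0 by linarith)]
  obtain ⟨x, rfl⟩ : ∃ x, b = a * x := ⟨b / a, by field_simp⟩
  have hx : 0 ≤ x := nonneg_of_mul_nonneg_right hb h
  have hx1 : x ≤ 1 := by nlinarith
  have e1 : a + a * x = a * (1 + x) := by ring
  have e2 : a - a * x = a * (1 - x) := by ring
  have e3 : a ^ 2 + (p - 1) * (a * x) ^ 2 = a ^ 2 * (1 + (p - 1) * x ^ 2) := by ring
  have e4 : (a ^ 2) ^ (p / 2) = a ^ p := by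
    rw [← Real.rpow_natCast, ← Real.rpow_mul h.le]; congr 1; push_cast; ring
  have q0 : 0 ≤ (p - 1) * x ^ 2 := mul_nonneg (by linarith) (sq_nonneg _)
  rw [e1, e2, e3, abs_of_nonneg (mul_nonneg h.le (by linarith)),
    abs_of_nonneg (mul_nonneg h.le (by linarith)), Real.mul_rpow h.le (by linarith),
    Real.mul_rpow h.le (by linarith), Real.mul_rpow (by positivity) (by linarith), e4]
  have h1 := phi p hp hp2 x hx hx1
  have h2 := rpow_one_add_le_one_add_mul_self (s := (p - 1) * x ^ 2) (by linarith)
    (p := p / 2) (by linarith) (by linarith)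
  have ap : 0 < a ^ p := Real.rpow_pos_of_pos h _
  nlinarith

lemma two2 (p : ℝ) (hp : 1 < p) (hp2 : p ≤ 2) (a b : ℝ) (ha : 0 ≤ a) (hb : 0 ≤ b) :
    2 * (a ^ 2 + (p - 1) * b ^ 2) ^ (p / 2) ≤ |a + b| ^ p + |a - b| ^ p := by
  rcases le_total b a with h | h
  · exact two1 p hp hp2 a b hb h
  · have := two1 p hp hp2 b a ha h
    rw [add_comm b a, abs_sub_comm b a] at this
    refine le_trans ?_ this
    have : a ^ 2 ≤ b ^ 2 := by gcongr
    have : 0 ≤ (p - 1) * b ^ 2 := mul_nonneg (by linarith) (sq_nonneg _)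
    have : (a ^ 2 + (p - 1) * b ^ 2) ≤ (b ^ 2 + (p - 1) * a ^ 2) := by nlinarith
    gcongr

lemma two3 (p : ℝ) (hp : 1 < p) (hp2 : p ≤ 2) (a b : ℝ) :
    2 * (a ^ 2 + (p - 1) * b ^ 2) ^ (p / 2) ≤ |a + b| ^ p + |a - b| ^ p := by
  have := two2 p hp hp2 |a| |b| (abs_nonneg _) (abs_nonneg _)
  rw [sq_abs, sq_abs] at this
  refine this.trans_eq ?_
  rcases le_total 0 a with ha | ha <;> rcases le_total 0 b with hb | hb
  · rw [abs_of_nonneg ha, abs_of_nonneg hb]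
  · rw [abs_of_nonneg ha, abs_of_nonpos hb]; rw [add_comm]; congr 3 <;> ring
  · rw [abs_of_nonpos ha, abs_of_nonneg hb, add_comm]
    rw [← abs_neg (-a - b), ← abs_neg (-a + b)]; congr 3 <;> ring
  · rw [abs_of_nonpos ha, abs_of_nonpos hb]
    rw [← abs_neg (-a + -b), ← abs_neg (-a - -b)]; congr 3 <;> ring

/-- concavity: pointwise reverse Minkowski -/
lemma conc (q : ℝ) (hq : 0 < q) (hq1 : q ≤ 1) (F G A B : ℝ) (hF : 0 ≤ F) (hG : 0 ≤ G)
    (hA : 0 < A) (hB : 0 < B) :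
    (A + B) ^ (q - 1) * (A ^ (1 - q) * F ^ q + B ^ (1 - q) * G ^ q) ≤ (F + G) ^ q := by
  have hS : 0 < A + B := by linarith
  have h := (Real.concaveOn_rpow hq.le hq1).2
    (show F * (A + B) / A ∈ Set.Ici 0 from Set.mem_Ici.2 (by positivity))
    (show G * (A + B) / B ∈ Set.Ici 0 from Set.mem_Ici.2 (by positivity))
    (show 0 ≤ A / (A + B) by positivity) (show 0 ≤ B / (A + B) by positivity) (by field_simp)
  simp only [smul_eq_mul] at h
  have e : A / (A + B) * (F * (A + B) / A) + B / (A + B) * (G * (A + B) / B) = F + G := by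
    field_simp
  rw [e] at h
  refine le_trans (le_of_eq ?_) h
  rw [Real.div_rpow (by positivity) hA.le, Real.div_rpow (by positivity) hB.le,
    Real.mul_rpow hF hS.le, Real.mul_rpow hG hS.le, Real.rpow_sub_one hS.ne',
    Real.rpow_sub hA, Real.rpow_sub hB, Real.rpow_one, Real.rpow_one]
  field_simp

/-- unit vectors, 2 ≤ p -/
lemma unit_big {X : Type*} [MeasurableSpace X] (μ : Measure X) (p : ℝ) (hp : 2 ≤ p)
    (f g : X → ℝ) (hf : MemLp f (ENNReal.ofReal p) μ) (hg : MemLp g (ENNReal.ofReal p) μ)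
    (nf : lpNormR μ p f = 1) (ng : lpNormR μ p g = 1) :
    lpNormR μ p (fun x => f x + g x) ≤
      2 - 1 / (p * 2 ^ (p - 1)) * lpNormR μ p (fun x => f x - g x) ^ p := by
  have hp1 : 1 < p := by linarith
  have i1 := nint μ p hp1 _ (hf.add hg)
  have i2 := nint μ p hp1 _ (hf.sub hg)
  have i3 := nint μ p hp1 _ hf
  have i4 := nint μ p hp1 _ hg
  have h := integral_mono (i1.add i2) ((i3.add i4).const_mul (2 ^ (p - 1)))
    (fun x => clark p hp (f x) (g x))
  have ha : ∫ x, ((fun x => |(f + g) x| ^ p) + fun x => |(f - g) x| ^ p) x ∂μ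
    = lpNormR μ p (fun x => f x + g x) ^ p + lpNormR μ p (fun x => f x - g x) ^ p := by
    rw [npow μ p hp1, npow μ p hp1]; exact integral_add i1 i2
  have hb : ∫ x, 2 ^ (p - 1) * ((fun x => |f x| ^ p) + fun x => |g x| ^ p) x ∂μ
    = 2 ^ (p - 1) * 2 := by
    rw [integral_const_mul]
    congr 1
    have : (2:ℝ) = lpNormR μ p f ^ p + lpNormR μ p g ^ p := by
      rw [nf, ng, Real.one_rpow]; norm_num
    rw [this, npow μ p hp1, npow μ p hp1]; exact integral_add i3 i4
  rw [ha, hb] at h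
  have n1 := nn μ p (fun x => f x + g x)
  generalize lpNormR μ p (fun x => f x + g x) = S at *
  generalize lpNormR μ p (fun x => f x - g x) ^ p = D at *
  have b := one_add_mul_self_le_rpow_one_add (s := S / 2 - 1) (by linarith) hp1.le
  have e : 1 + (S / 2 - 1) = S / 2 := by ring
  rw [e, Real.div_rpow n1 (by norm_num)] at b
  have e2 : (2:ℝ) ^ (p - 1) * 2 = 2 ^ p := by
    rw [Real.rpow_sub_one (by norm_num)]; ring
  rw [e2] at h
  have k0 : (0:ℝ) < 2 ^ (p - 1) := by positivity
  generalize (2:ℝ) ^ (p - 1) = k at *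
  rw [← e2] at b h
  rw [le_div_iff₀ (by positivity)] at b
  rw [le_sub_iff_add_le, ← le_sub_iff_add_le', one_div_mul_eq_div, div_le_iff₀ (by positivity)]
  nlinarith

/-- unit vectors, p ≤ 2 -/
lemma unit_small {X : Type*} [MeasurableSpace X] (μ : Measure X) (p : ℝ) (hp : 1 < p) (hp2 : p ≤ 2)
    (f g : X → ℝ) (hf : MemLp f (ENNReal.ofReal p) μ) (hg : MemLp g (ENNReal.ofReal p) μ)
    (nf : lpNormR μ p f = 1) (ng : lpNormR μ p g = 1) :
    lpNormR μ p (fun x => f x + g x) ≤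
      2 - (p - 1) / 4 * lpNormR μ p (fun x => f x - g x) ^ 2 := by
  have i1 := nint μ p hp _ (hf.add hg)
  have i2 := nint μ p hp _ (hf.sub hg)
  have i3 := nint μ p hp _ hf
  have i4 := nint μ p hp _ hg
  have n1 := nn μ p (fun x => f x + g x)
  have n2 := nn μ p (fun x => f x - g x)
  have tri : lpNormR μ p (fun x => f x + g x) ≤ 2 := by
    have := nadd μ p hp f g hf hg
    linarith
  have tri2 : lpNormR μ p (fun x => f x - g x) ≤ 2 := by
    have := nadd μ p hp f (fun x => - g x) hf hg.neg
    have e : lpNormR μ p (fun x => - g x) = lpNormR μ p g := by simp [lpNormR]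
    simp only [← sub_eq_add_neg] at this
    linarith
  rcases n2.eq_or_lt with z | pD
  · rw [← z]; simpa using tri
  rcases n1.eq_or_lt with z | pS
  · rw [← z]; nlinarith
  have key : ∀ z : ℝ, |z| ^ p = (z ^ 2) ^ (p / 2) := fun z => by
    rw [← sq_abs, ← Real.rpow_natCast, ← Real.rpow_mul (abs_nonneg _)]
    congr 1; push_cast; ring
  set S := lpNormR μ p (fun x => f x + g x) with hS
  set D := lpNormR μ p (fun x => f x - g x) with hD
  have c0 : 0 < p - 1 := by linarith
  have hpt : ∀ x, (S ^ 2 + (p - 1) * D ^ 2) ^ (p / 2 - 1) *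
      ((S ^ 2) ^ (1 - p / 2) * |f x + g x| ^ p +
        ((p - 1) * D ^ 2) ^ (1 - p / 2) * ((p - 1) ^ (p / 2) * |f x - g x| ^ p))
      ≤ 2 ^ (p - 1) * (|f x| ^ p + |g x| ^ p) := by
    intro x
    have h1 := conc (p / 2) (by linarith) (by linarith) ((f x + g x) ^ 2)
      ((p - 1) * (f x - g x) ^ 2) (S ^ 2) ((p - 1) * D ^ 2) (by positivity) (by positivity)
      (by positivity) (by positivity)
    have h2 := two3 p hp hp2 (f x + g x) (f x - g x)
    rw [Real.mul_rpow c0.le (sq_nonneg (f x - g x)), ← key, ← key] at h1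
    have e1 : f x + g x + (f x - g x) = 2 * f x := by ring
    have e2 : f x + g x - (f x - g x) = 2 * g x := by ring
    rw [e1, e2, abs_mul, abs_mul, abs_two, Real.mul_rpow (by norm_num) (abs_nonneg _),
      Real.mul_rpow (by norm_num) (abs_nonneg _)] at h2
    have e3 : (2:ℝ) ^ p = 2 ^ (p - 1) * 2 := by
      rw [Real.rpow_sub_one (by norm_num)]; ring
    rw [e3] at h2
    linarith
  have j1 : Integrable (fun x => (S ^ 2) ^ (1 - p / 2) * |f x + g x| ^ p) μ := i1.const_mul _
  have j2 : Integrable (fun x => ((p - 1) * D ^ 2) ^ (1 - p / 2) *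
    ((p - 1) ^ (p / 2) * |f x - g x| ^ p)) μ := (i2.const_mul _).const_mul _
  have h := integral_mono ((j1.add j2).const_mul _) ((i3.add i4).const_mul (2 ^ (p - 1))) hpt
  have hb : ∫ x, 2 ^ (p - 1) * ((fun x => |f x| ^ p) + fun x => |g x| ^ p) x ∂μ
    = 2 ^ (p - 1) * 2 := by
    rw [integral_const_mul]
    congr 1
    have : (2:ℝ) = lpNormR μ p f ^ p + lpNormR μ p g ^ p := by
      rw [nf, ng, Real.one_rpow]; norm_num
    rw [this, npow μ p hp, npow μ p hp]; exact integral_add i3 i4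
  rw [hb, integral_const_mul] at h
  have ha := integral_add j1 j2
  rw [integral_const_mul, integral_const_mul, integral_const_mul, ← npow μ p hp, ← npow μ p hp,
    ← hS, ← hD, ← abs_of_pos pS, ← abs_of_pos pD, key, key, abs_of_pos pS, abs_of_pos pD,
    ← Real.mul_rpow c0.le (sq_nonneg D), ← Real.rpow_add (by positivity),
    ← Real.rpow_add (by positivity), sub_add_cancel, Real.rpow_one, Real.rpow_one] at ha
  have h' : (S ^ 2 + (p - 1) * D ^ 2) ^ (p / 2 - 1) * (S ^ 2 + (p - 1) * D ^ 2)
      ≤ 2 ^ (p - 1) * 2 := by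
    have h3 := h.trans_eq' (congrArg (fun t => (S ^ 2 + (p - 1) * D ^ 2) ^ (p / 2 - 1) * t) ha)
    exact h3
  have pT : 0 < S ^ 2 + (p - 1) * D ^ 2 := by positivity
  rw [← Real.rpow_add_one pT.ne', sub_add_cancel, ← Real.rpow_add_one (by norm_num),
    sub_add_cancel] at h'
  have e4 : (2:ℝ) ^ p = 4 ^ (p / 2) := by
    have := key 2
    rw [abs_two] at this
    rw [this]; norm_num
  rw [e4, Real.rpow_le_rpow_iff pT.le (by norm_num) (by linarith)] at h'
  nlinarith [sq_nonneg (S - 2)]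

/-- **Quantitative strengthening of the triangle inequality in `L^p`.**
For `h₁, h₂ ∈ L^p(X,μ)` with `0 < ‖h₁‖_p ≤ ‖h₂‖_p`:
(i) if `1 < p ≤ 2`, `‖h₁+h₂‖_p ≤ ‖h₁‖_p + ‖h₂‖_p − ((p−1)‖h₁‖_p/4)‖h₁/‖h₁‖_p − h₂/‖h₂‖_p‖_p²`;
(ii) if `2 ≤ p < ∞`, `‖h₁+h₂‖_p ≤ ‖h₁‖_p + ‖h₂‖_p − (‖h₁‖_p/(p2^{p−1}))‖h₁/‖h₁‖_p − h₂/‖h₂‖_p‖_p^p`. -/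
theorem lp_triangle_strengthened {X : Type*} [MeasurableSpace X] (μ : Measure X)
    (p : ℝ) (hp : 1 < p) (h₁ h₂ : X → ℝ)
    (hh₁ : MemLp h₁ (ENNReal.ofReal p) μ) (hh₂ : MemLp h₂ (ENNReal.ofReal p) μ)
    (h₁pos : 0 < lpNormR μ p h₁) (hle : lpNormR μ p h₁ ≤ lpNormR μ p h₂) :
    (p ≤ 2 →
      lpNormR μ p (fun x => h₁ x + h₂ x) ≤
        lpNormR μ p h₁ + lpNormR μ p h₂ -
          (p - 1) * lpNormR μ p h₁ / 4 *
            lpNormR μ p (fun x => h₁ x / lpNormR μ p h₁ - h₂ x / lpNormR μ p h₂) ^ 2) ∧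
    (2 ≤ p →
      lpNormR μ p (fun x => h₁ x + h₂ x) ≤
        lpNormR μ p h₁ + lpNormR μ p h₂ -
          lpNormR μ p h₁ / (p * 2 ^ (p - 1)) *
            lpNormR μ p (fun x => h₁ x / lpNormR μ p h₁ - h₂ x / lpNormR μ p h₂) ^ p) := by
  have h₂pos := h₁pos.trans_le hle
  set a := lpNormR μ p h₁ with ha
  set b := lpNormR μ p h₂ with hb
  have mf : MemLp (fun x => h₁ x / a) (ENNReal.ofReal p) μ := by
    simpa [div_eq_inv_mul] using hh₁.const_mul a⁻¹
  have mg : MemLp (fun x => h₂ x / b) (ENNReal.ofReal p) μ := by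
    simpa [div_eq_inv_mul] using hh₂.const_mul b⁻¹
  have nf : lpNormR μ p (fun x => h₁ x / a) = 1 := by
    simp only [div_eq_inv_mul]
    rw [nsmul' μ p hp _ _ (by positivity), ← ha]; field_simp
  have ng : lpNormR μ p (fun x => h₂ x / b) = 1 := by
    simp only [div_eq_inv_mul]
    rw [nsmul' μ p hp _ _ (by positivity), ← hb]; field_simp
  have main : lpNormR μ p (fun x => h₁ x + h₂ x) ≤
      a * lpNormR μ p (fun x => h₁ x / a + h₂ x / b) + (b - a) := by
    have h := nadd μ p hp (fun x => a * (h₁ x / a + h₂ x / b)) (fun x => (b - a) * (h₂ x / b))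
      ((mf.add mg).const_mul a) (mg.const_mul (b - a))
    rw [nsmul' μ p hp _ _ h₁pos.le, nsmul' μ p hp _ _ (sub_nonneg.2 hle), ng, mul_one] at h
    refine le_trans (le_of_eq ?_) h
    congr 1
    funext x
    field_simp
    ring
  constructor
  · intro h2
    have u := mul_le_mul_of_nonneg_left (unit_small μ p hp h2 _ _ mf mg nf ng) h₁pos.le
    refine main.trans ((add_le_add_left u (b - a)).trans_eq ?_)
    ring
  · intro h2
    have u := mul_le_mul_of_nonneg_left (unit_big μ p h2 _ _ mf mg nf ng) h₁pos.le
    refine main.trans ((add_le_add_left u (b - a)).trans_eq ?_)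
    ring
end
end

section
/- Let n ≥ 2 be an integer, m > 0 a real number, γ = (m+n−2)/2, and let d be an integer with d > (n+1)/2. Then the double series Σ_{j≥0} Σ_{l≥0} (C(n+l−1, l) − C(n+l−2, l−1)) / (γ² + 4j(j + (m+n)/2 − 1) + l(l + n − 2))^d converges (is finite), where C(a,b) denotes the binomial coefficient and the term C(n+l−2, l−1) is interpreted as 0 when l = 0. -/
noncomputable section

theorem aux_mult (n l : ℕ) (hn : 2 ≤ n) :
    (((n + l - 1).choose l : ℝ) -
          (if l = 0 then 0 else ((n + l - 2).choose (l - 1) : ℝ))) = ((n - 2 + l).choose l : ℝ) := by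
  obtain ⟨k, rfl⟩ := Nat.exists_eq_add_of_le hn
  rcases l with _ | l
  · simp
  · have h1 : 2 + k + (l + 1) - 1 = (k + l + 1) + 1 := by omega
    have h2 : 2 + k + (l + 1) - 2 = k + l + 1 := by omega
    have h3 : 2 + k - 2 + (l + 1) = k + l + 1 := by omega
    rw [h1, h2, h3, Nat.choose_succ_succ]
    simp

theorem aux_choose (n l : ℕ) (hn : 2 ≤ n) :
    ((n - 2 + l).choose l : ℝ) ≤ (n : ℝ) ^ (n - 2) * ((l : ℝ) + 1) ^ (n - 2) := by
  rw [← mul_pow]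
  have h : (n - 2 + l).choose l ≤ (n * (l + 1)) ^ (n - 2) := by
    rw [← Nat.choose_symm_add]
    refine (Nat.choose_le_pow _ _).trans (Nat.pow_le_pow_left ?_ _)
    have : l ≤ n * l := Nat.le_mul_of_pos_left _ (by omega)
    rw [mul_add]
    omega
  exact_mod_cast h

theorem aux_pow (n d : ℕ) (hn : 2 ≤ n) (hd : n + 2 ≤ 2 * d) (a b : ℝ) (ha : 1 ≤ a) (hb : 1 ≤ b) :
    b ^ (n - 2) * (a ^ 2 * b ^ 2) ≤ (a ^ 2 + b ^ 2) ^ d := by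
  have hS : 1 ≤ a ^ 2 + b ^ 2 := by nlinarith
  have hb2 : b ^ 2 ≤ a ^ 2 + b ^ 2 := by nlinarith
  have hab : a * b ≤ a ^ 2 + b ^ 2 := by nlinarith [sq_nonneg (a - b)]
  refine (pow_le_pow_iff_left₀ (by positivity) (by positivity) two_ne_zero).1 ?_
  calc (b ^ (n - 2) * (a ^ 2 * b ^ 2)) ^ 2 = (b ^ 2) ^ (n - 2) * (a * b) ^ 4 := by
        rw [← pow_mul, mul_comm 2, pow_mul]; ring
    _ ≤ (a ^ 2 + b ^ 2) ^ (n - 2) * (a ^ 2 + b ^ 2) ^ 4 := by gcongr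
    _ = (a ^ 2 + b ^ 2) ^ (n + 2) := by rw [← pow_add]; congr 1; omega
    _ ≤ (a ^ 2 + b ^ 2) ^ (2 * d) := pow_le_pow_right₀ hS hd
    _ = ((a ^ 2 + b ^ 2) ^ d) ^ 2 := by rw [← pow_mul, mul_comm]

/-- **Summability of the eigenvalue series.** For integer `n ≥ 2`, real `m > 0`,
`γ = (m+n−2)/2`, and an integer `d > (n+1)/2`, the double series
`Σ_{j,l ≥ 0} (C(n+l−1,l) − C(n+l−2,l−1)) / (γ² + 4j(j+(m+n)/2−1) + l(l+n−2))^d`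
converges, where the term `C(n+l−2,l−1)` is interpreted as `0` when `l = 0`. -/
theorem eigenvalue_series_summable (n : ℕ) (hn : 2 ≤ n) (m : ℝ) (hm : 0 < m)
    (d : ℕ) (hd : ((n : ℝ) + 1) / 2 < d) :
    Summable (fun jl : ℕ × ℕ =>
      (((n + jl.2 - 1).choose jl.2 : ℝ) -
          (if jl.2 = 0 then 0 else ((n + jl.2 - 2).choose (jl.2 - 1) : ℝ))) /
        (((m + n - 2) / 2) ^ 2 +
            4 * jl.1 * (jl.1 + (m + n) / 2 - 1) +
            jl.2 * (jl.2 + n - 2)) ^ d) := by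
  have hn' : (2 : ℝ) ≤ n := by exact_mod_cast hn
  have hd' : n + 2 ≤ 2 * d := by
    have : (n : ℝ) + 1 < 2 * d := by linarith
    have : n + 1 < 2 * d := by exact_mod_cast this
    omega
  set g : ℝ := (m + n - 2) / 2 with hg
  have hgpos : 0 < g := by rw [hg]; linarith
  have hc : ∃ c : ℝ, 0 < c ∧ 4 * c ≤ g ^ 2 ∧ 4 * c ≤ 1 :=
    ⟨min (g ^ 2) 1 / 4, by positivity, by linarith [min_le_left (g ^ 2) 1],
      by linarith [min_le_right (g ^ 2) 1]⟩
  obtain ⟨c, hc0, hc1, hc2⟩ := hc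
  have hs : Summable (fun j : ℕ => 1 / ((j : ℝ) + 1) ^ 2) := by
    have := (summable_nat_add_iff 1).2 (Real.summable_one_div_nat_pow.2 (one_lt_two))
    simpa using this
  have hs2 := ((hs.mul_of_nonneg hs (fun _ => by positivity) (fun _ => by positivity)).mul_left
    ((n : ℝ) ^ (n - 2) / c ^ d))
  have key : ∀ j l : ℕ, c * (((j : ℝ) + 1) ^ 2 + ((l : ℝ) + 1) ^ 2) ≤
      g ^ 2 + 4 * j * (j + (m + n) / 2 - 1) + l * (l + n - 2) := by
    intro j l
    have hj : (0 : ℝ) ≤ j := j.cast_nonneg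
    have hl : (0 : ℝ) ≤ l := l.cast_nonneg
    have h1 : (j : ℝ) + (m + n) / 2 - 1 = j + g := by rw [hg]; ring
    rw [h1]
    have h2 : ((j : ℝ) + 1) ^ 2 + ((l : ℝ) + 1) ^ 2 ≤ 2 * j ^ 2 + 2 * l ^ 2 + 4 := by
      nlinarith [sq_nonneg ((j : ℝ) - 1), sq_nonneg ((l : ℝ) - 1)]
    have h3 := mul_le_mul_of_nonneg_left h2 hc0.le
    have h4 : 0 ≤ (j : ℝ) * g := by positivity
    have h5 : 0 ≤ (l : ℝ) * (n - 2) := mul_nonneg hl (by linarith)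
    have h6 : 4 * c * (j : ℝ) ^ 2 ≤ 1 * (j : ℝ) ^ 2 := by gcongr
    have h7 : 4 * c * (l : ℝ) ^ 2 ≤ 1 * (l : ℝ) ^ 2 := by gcongr
    nlinarith [sq_nonneg (j : ℝ), sq_nonneg (l : ℝ)]
  refine Summable.of_nonneg_of_le ?_ ?_ hs2
  · rintro ⟨j, l⟩
    dsimp only
    rw [aux_mult n l hn]
    have : 0 ≤ g ^ 2 + 4 * j * (j + (m + n) / 2 - 1) + l * (l + n - 2) :=
      le_trans (by positivity) (key j l)
    positivity
  · rintro ⟨j, l⟩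
    dsimp only
    rw [aux_mult n l hn]
    have hp := aux_pow n d hn hd' ((j : ℝ) + 1) ((l : ℝ) + 1) (by simp) (by simp)
    have hk := pow_le_pow_left₀ (by positivity) (key j l) d
    rw [mul_pow] at hk
    have hD : 0 < c ^ d * (((j : ℝ) + 1) ^ 2 + ((l : ℝ) + 1) ^ 2) ^ d := by positivity
    calc _ ≤ (n : ℝ) ^ (n - 2) * ((l : ℝ) + 1) ^ (n - 2) /
          (c ^ d * (((l : ℝ) + 1) ^ (n - 2) * (((j : ℝ) + 1) ^ 2 * ((l : ℝ) + 1) ^ 2))) := by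
          refine div_le_div₀ (by positivity) (aux_choose n l hn) (by positivity) ?_
          refine le_trans ?_ hk
          gcongr
      _ = _ := by field_simp
end
end
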